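/- Fix α > 0 and d > 0. There exist a function r : (0, ∞) → ℝ, infinitely differentiable, satisfying 2s² r' r''' − s² (r'')² + 2s r' r'' − 4s (r')³ + (2r − 1/4)(r')² + 1 = 0 on (0, ∞), with lim_{s→0⁺} r(s) = (1 − 4α²)/8 and r(s) − ((3/2) s^{2/3} − α s^{1/3}) bounded as s → +∞, and constants C > 0 and N ∈ ℕ, such that for every integer n ≥ N and every t ∈ (0, d], writing s = 2nt, the recurrence coefficient satisfies β_n(t) = n² + αn + ((4α² − 1 + 8 r(s) − 8 s r'(s))/16) (1 + ε_n(t)) with |ε_n(t)| ≤ C n^{−1/3}. -/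

import Mathlib

open MeasureTheory Set Filter Topology

/-- The singularly perturbed Laguerre weight `w(x; t, α) = x^α e^{-x - t/x}`. -/
noncomputable def pertLagWeight (α t x : ℝ) : ℝ := x ^ α * Real.exp (-x - t / x)

namespace PertLaguerre

/-- At a maximum the second derivative is nonpositive. -/
theorem second_deriv_nonpos_of_max {w w₁ : ℝ → ℝ} {τ c : ℝ}
    (hw : ∀ x, HasDerivAt w (w₁ x) x) (hc : HasDerivAt w₁ c τ)
    (hmax : ∀ x, w x ≤ w τ) : c ≤ 0 := by
  by_contra! hpos
  have h0 : w₁ τ = 0 := by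
    have hl : IsLocalMax w τ := Filter.Eventually.of_forall hmax
    exact hl.hasDerivAt_eq_zero (hw τ)
  have hs := (hasDerivAt_iff_tendsto_slope.1 hc).eventually (lt_mem_nhds hpos)
  have hs' : ∀ᶠ x in 𝓝[>] τ, 0 < slope w₁ τ x :=
    hs.filter_mono (nhdsWithin_mono _ fun x hx => ne_of_gt hx)
  obtain ⟨u, hu, hsub⟩ := mem_nhdsGT_iff_exists_Ioo_subset.1 hs'
  have hu' : τ < u := hu
  have hmono : StrictMonoOn w (Icc τ ((τ + u) / 2)) := by
    apply strictMonoOn_of_deriv_pos (convex_Icc _ _)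
    · exact fun x _ => (hw x).continuousAt.continuousWithinAt
    · intro x hx
      rw [interior_Icc] at hx
      have hx' : 0 < slope w₁ τ x := hsub ⟨hx.1, by linarith [hx.2]⟩
      rw [slope_def_field, h0, sub_zero] at hx'
      rw [(hw x).deriv]
      exact (div_pos_iff_of_pos_right (by linarith [hx.1])).1 hx'
  have := hmono (left_mem_Icc.2 (by linarith)) (right_mem_Icc.2 (by linarith)) (by linarith)
  linarith [hmax ((τ + u) / 2)]

theorem tendsto_linear_sub_cosh {c ε : ℝ} (A B : ℝ) (hc : 0 < c) (hε : 0 < ε) :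
    Tendsto (fun x : ℝ => A + B * |x| - ε * Real.cosh (c * x)) (cocompact ℝ) atBot := by
  have h1 : Tendsto (fun y : ℝ => A + B * y - ε / 2 * Real.exp (c * y)) atTop atBot := by
    have h2 : Tendsto (fun y : ℝ => Real.exp (c * y) / y) atTop atTop := by
      have := (Real.tendsto_mul_exp_add_div_pow_atTop 1 0 1 one_pos).comp
        (tendsto_id.const_mul_atTop hc)
      have h3 := this.const_mul_atTop hc
      refine h3.congr' ?_
      filter_upwards [eventually_gt_atTop 0] with y hy
      simp
      field_simp
    have h3 : Tendsto (fun y : ℝ => (B + A / y) + (-(ε / 2)) * (Real.exp (c * y) / y))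
        atTop atBot := by
      apply Tendsto.add_atBot (C := B + 0)
      · exact tendsto_const_nhds.add (tendsto_const_nhds.div_atTop tendsto_id)
      · exact h2.const_mul_atTop_of_neg (by linarith)
    have h4 := Tendsto.atTop_mul_atBot₀ tendsto_id h3
    refine h4.congr' ?_
    filter_upwards [eventually_gt_atTop 0] with y hy
    simp
    field_simp
    ring
  have h5 : Tendsto (fun x : ℝ => |x|) (cocompact ℝ) atTop := tendsto_norm_cocompact_atTop
  refine tendsto_atBot_mono (fun x => ?_) (h1.comp h5)
  simp only [Function.comp]
  have : Real.exp (c * |x|) ≤ 2 * Real.cosh (c * x) := by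
    rw [← Real.cosh_abs, abs_mul, abs_of_pos hc, Real.cosh_eq]
    linarith [Real.exp_pos (-(c * |x|))]
  nlinarith

/-- A one-dimensional Phragmén–Lindelöf maximum principle. -/
theorem max_principle {w w₁ w₂ : ℝ → ℝ} {c A B : ℝ} (hc : 0 < c)
    (hw : ∀ x, HasDerivAt w (w₁ x) x) (hw₁ : ∀ x, HasDerivAt w₁ (w₂ x) x)
    (h : ∀ x, 0 < w x → c ^ 2 * w x ≤ w₂ x) (hg : ∀ x, w x ≤ A + B * |x|) (x : ℝ) :
    w x ≤ 0 := by
  have key : ∀ ε > 0, w x ≤ ε * Real.cosh (c * x) := by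
    intro ε hε
    set φ : ℝ → ℝ := fun y => w y - ε * Real.cosh (c * y) with hφ
    have hφ' : ∀ y, HasDerivAt φ (w₁ y - ε * (Real.sinh (c * y) * c)) y := fun y =>
      (hw y).sub (((((hasDerivAt_id y).const_mul c).congr_deriv (by simp)).cosh).const_mul ε)
    have hφ'' : ∀ y, HasDerivAt (fun y => w₁ y - ε * (Real.sinh (c * y) * c))
        (w₂ y - ε * (Real.cosh (c * y) * c * c)) y := fun y =>
      (hw₁ y).sub ((((((hasDerivAt_id y).const_mul c).congr_deriv (by simp)).sinh).mul_const
        c).const_mul ε)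
    have hcont : Continuous φ := continuous_iff_continuousAt.2 fun y => (hφ' y).continuousAt
    have hlim : Tendsto φ (cocompact ℝ) atBot :=
      tendsto_atBot_mono (fun y => by simp only [hφ]; linarith [hg y])
        (tendsto_linear_sub_cosh A B hc hε)
    obtain ⟨y, hy⟩ := hcont.exists_forall_ge hlim
    have h2 := second_deriv_nonpos_of_max hφ' (hφ'' y) hy
    have h3 : φ y ≤ 0 := by
      by_contra! h4
      have hch : 0 < Real.cosh (c * y) := Real.cosh_pos _
      have h5 : 0 < w y := by simp only [hφ] at h4; nlinarith
      have := h y h5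
      simp only [hφ] at h4
      nlinarith [mul_pos (pow_pos hc 2) h4]
    have := hy x
    simp only [hφ] at this h3
    linarith
  have hl : Tendsto (fun ε : ℝ => ε * Real.cosh (c * x)) (𝓝[>] 0) (𝓝 (0 * Real.cosh (c * x))) :=
    ((tendsto_id).mul_const _).mono_left nhdsWithin_le_nhds
  rw [zero_mul] at hl
  exact ge_of_tendsto hl (by filter_upwards [self_mem_nhdsWithin] with ε hε using key ε hε)

/-- A function with `D' ≥ -c D`, `c ≥ c₀ > 0`, bounded below near `-∞`, is nonnegative. -/
theorem nonneg_of_deriv_ge {D D₁ c : ℝ → ℝ} {c₀ K T : ℝ} (hc₀ : 0 < c₀) (hc : Continuous c)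
    (hcc : ∀ x, c₀ ≤ c x) (hD : ∀ x, HasDerivAt D (D₁ x) x)
    (h : ∀ x ≤ T, -c x * D x ≤ D₁ x) (hK : ∀ x ≤ 0, -K ≤ D x) {x : ℝ} (hx : x ≤ T) :
    0 ≤ D x := by
  set C : ℝ → ℝ := fun y => ∫ u in (0:ℝ)..y, c u with hCdef
  have hC : ∀ y, HasDerivAt C (c y) y := fun y =>
    intervalIntegral.integral_hasDerivAt_right (hc.intervalIntegrable _ _)
      (hc.stronglyMeasurableAtFilter _ _) hc.continuousAt
  set E : ℝ → ℝ := fun y => D y * Real.exp (C y) with hE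
  have hE' : ∀ y, HasDerivAt E (D₁ y * Real.exp (C y) + D y * (Real.exp (C y) * c y)) y :=
    fun y => (hD y).mul (hC y).exp
  have hmono : MonotoneOn E (Iic T) := by
    apply monotoneOn_of_deriv_nonneg (convex_Iic T)
    · exact fun y _ => (hE' y).continuousAt.continuousWithinAt
    · exact fun y _ => (hE' y).differentiableAt.differentiableWithinAt
    · intro y hy
      rw [interior_Iic] at hy
      rw [(hE' y).deriv]
      have := h y (le_of_lt hy)
      nlinarith [mul_nonneg (sub_nonneg.2 this) (Real.exp_pos (C y)).le]
  have hCle : ∀ y ≤ 0, C y ≤ c₀ * y := by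
    intro y hy
    have : (∫ u in y..(0:ℝ), c₀) ≤ ∫ u in y..(0:ℝ), c u :=
      intervalIntegral.integral_mono_on hy (by simp) (hc.intervalIntegrable _ _)
        fun u _ => hcc u
    simp only [intervalIntegral.integral_const, smul_eq_mul] at this
    simp only [hCdef]
    rw [intervalIntegral.integral_symm]
    linarith
  have hlim : Tendsto (fun y : ℝ => -|K| * Real.exp (c₀ * y)) atBot (𝓝 0) := by
    have : Tendsto (fun y : ℝ => Real.exp (c₀ * y)) atBot (𝓝 0) :=
      Real.tendsto_exp_atBot.comp (tendsto_id.const_mul_atBot hc₀)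
    simpa using this.const_mul (-|K|)
  have hEx : 0 ≤ E x := by
    refine le_of_tendsto hlim ?_
    filter_upwards [eventually_le_atBot 0, eventually_le_atBot x] with y hy hyx
    have h1 : E y ≤ E x := hmono (show y ≤ T by linarith) hx hyx
    have h2 : -|K| ≤ D y := (neg_le_neg (le_abs_self K)).trans (hK y hy)
    have h3 : Real.exp (C y) ≤ Real.exp (c₀ * y) := Real.exp_le_exp.2 (hCle y hy)
    have h4 : -|K| * Real.exp (c₀ * y) ≤ -|K| * Real.exp (C y) := by
      nlinarith [abs_nonneg K]
    have h5 : -|K| * Real.exp (C y) ≤ E y := by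
      simp only [hE]
      exact mul_le_mul_of_nonneg_right h2 (Real.exp_pos _).le
    linarith
  exact nonneg_of_mul_nonneg_left hEx (Real.exp_pos _)

/-- Interpolation: the first derivative is controlled by the function and its second derivative. -/
theorem abs_deriv_le {w w₁ w₂ : ℝ → ℝ} {a A B : ℝ}
    (hw : ∀ x, HasDerivAt w (w₁ x) x) (hw₁ : ∀ x, HasDerivAt w₁ (w₂ x) x)
    (hA : ∀ x ∈ Icc a (a + 1), |w x| ≤ A) (hB : ∀ x ∈ Icc a (a + 1), |w₂ x| ≤ B) :
    |w₁ a| ≤ 2 * A + B := by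
  obtain ⟨ξ, hξ, h1⟩ := exists_hasDerivAt_eq_slope w w₁ (show a < a + 1 by linarith)
    (fun x _ => (hw x).continuousAt.continuousWithinAt) (fun x _ => hw x)
  obtain ⟨η, hη, h2⟩ := exists_hasDerivAt_eq_slope w₁ w₂ hξ.1
    (fun x _ => (hw₁ x).continuousAt.continuousWithinAt) (fun x _ => hw₁ x)
  have hB' := hB η ⟨hη.1.le, by linarith [hη.2, hξ.2]⟩
  have e1 := abs_le.1 (hA a ⟨le_rfl, by linarith⟩)
  have e2 := abs_le.1 (hA (a + 1) ⟨by linarith, le_rfl⟩)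
  have hpos : 0 < ξ - a := by linarith [hξ.1]
  rw [eq_div_iff hpos.ne'] at h2
  have h3 : |w₂ η * (ξ - a)| ≤ B := by
    rw [abs_mul, abs_of_pos hpos]
    nlinarith [abs_nonneg (w₂ η), hξ.2]
  rw [h2] at h3
  have h4 := abs_le.1 h3
  have h5 : w₁ ξ = w (a + 1) - w a := by rw [h1]; simp
  rw [abs_le]
  constructor <;> linarith [h4.1, h4.2, e1.1, e1.2, e2.1, e2.2]

/-- Right-hand side of the Painlevé III type equation
`v'' = e^{2v} - α e^v - κ e^{τ-v} - ε e^{2(τ-v)}`. -/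
noncomputable def forcing (α κ ε τ v : ℝ) : ℝ :=
  Real.exp (2 * v) - α * Real.exp v - κ * Real.exp (τ - v) - ε * Real.exp (2 * (τ - v))

/-- Solutions `v` (with derivative `z`) of the equation with right-hand side `forcing`, bounded
below by `log α` and growing at most linearly. -/
structure IsSol (α κ ε : ℝ) (v z : ℝ → ℝ) : Prop where
  hasDerivAt : ∀ τ, HasDerivAt v (z τ) τ
  hasDerivAt_deriv : ∀ τ, HasDerivAt z (forcing α κ ε τ (v τ)) τ
  lower : ∀ τ, Real.log α ≤ v τ
  growth : ∃ A, ∀ τ, v τ ≤ A + max τ 0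

theorem IsSol.continuous {α κ ε : ℝ} {v z : ℝ → ℝ} (h : IsSol α κ ε v z) : Continuous v :=
  continuous_iff_continuousAt.2 fun τ => (h.hasDerivAt τ).continuousAt

theorem le_exp_of_log_le {α v : ℝ} (hα : 0 < α) (h : Real.log α ≤ v) : α ≤ Real.exp v := by
  rwa [← Real.log_le_iff_le_exp hα]

theorem IsSol.le_exp {α κ ε : ℝ} {v z : ℝ → ℝ} (h : IsSol α κ ε v z) (hα : 0 < α) (τ : ℝ) :
    α ≤ Real.exp (v τ) := le_exp_of_log_le hα (h.lower τ)

theorem exp_sub_exp_le (a b : ℝ) : Real.exp a - Real.exp b ≤ Real.exp a * (a - b) := by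
  have h1 := Real.add_one_le_exp (b - a)
  have h2 : Real.exp b = Real.exp a * Real.exp (b - a) := by rw [← Real.exp_add]; ring_nf
  rw [h2]
  nlinarith [Real.exp_pos a]

theorem le_exp_sub_exp (a b : ℝ) : Real.exp b * (a - b) ≤ Real.exp a - Real.exp b := by
  have := exp_sub_exp_le b a
  linarith

theorem exp_two_mul (v : ℝ) : Real.exp (2 * v) = Real.exp v ^ 2 := by
  rw [← Real.exp_nat_mul]; norm_num

theorem forcing_sub_forcing_ge {α κ ε τ v₁ v₂ : ℝ} (hα : 0 < α) (hκ : 0 ≤ κ) (hε : 0 ≤ ε)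
    (h₂ : Real.log α ≤ v₂) (h : v₂ ≤ v₁) :
    Real.exp v₂ ^ 2 * (v₁ - v₂) ≤ forcing α κ ε τ v₁ - forcing α κ ε τ v₂ := by
  have hα2 := le_exp_of_log_le hα h₂
  have h12 : Real.exp v₂ ≤ Real.exp v₁ := Real.exp_le_exp.2 h
  have e1 : Real.exp (τ - v₁) ≤ Real.exp (τ - v₂) := Real.exp_le_exp.2 (by linarith)
  have e2 : Real.exp (2 * (τ - v₁)) ≤ Real.exp (2 * (τ - v₂)) := Real.exp_le_exp.2 (by linarith)
  have e3 := le_exp_sub_exp v₁ v₂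
  simp only [forcing, exp_two_mul v₁, exp_two_mul v₂]
  have e4 : Real.exp v₂ ^ 2 * (v₁ - v₂) ≤
      (Real.exp v₁ - Real.exp v₂) * (Real.exp v₁ + Real.exp v₂ - α) := by
    have : Real.exp v₂ ^ 2 * (v₁ - v₂) ≤ (Real.exp v₁ - Real.exp v₂) * Real.exp v₂ := by
      nlinarith [Real.exp_pos v₂]
    nlinarith [mul_nonneg (sub_nonneg.2 h12) (show 0 ≤ Real.exp v₁ - α by linarith)]
  nlinarith [mul_nonneg hκ (sub_nonneg.2 e1), mul_nonneg hε (sub_nonneg.2 e2)]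

/-- Comparison of a subsolution `v₁` with a supersolution `v₂`. -/
theorem comparison {α κ ε A B : ℝ} {v₁ z₁ c₁ v₂ z₂ c₂ : ℝ → ℝ} (hα : 0 < α) (hκ : 0 ≤ κ)
    (hε : 0 ≤ ε) (hv₁ : ∀ τ, HasDerivAt v₁ (z₁ τ) τ) (hz₁ : ∀ τ, HasDerivAt z₁ (c₁ τ) τ)
    (hv₂ : ∀ τ, HasDerivAt v₂ (z₂ τ) τ) (hz₂ : ∀ τ, HasDerivAt z₂ (c₂ τ) τ)
    (h₁ : ∀ τ, forcing α κ ε τ (v₁ τ) ≤ c₁ τ) (h₂ : ∀ τ, c₂ τ ≤ forcing α κ ε τ (v₂ τ))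
    (hlow : ∀ τ, Real.log α ≤ v₂ τ) (hg : ∀ τ, v₁ τ - v₂ τ ≤ A + B * |τ|) (τ : ℝ) :
    v₁ τ ≤ v₂ τ := by
  have := max_principle (w := fun τ => v₁ τ - v₂ τ) hα
    (fun x => (hv₁ x).sub (hv₂ x)) (fun x => (hz₁ x).sub (hz₂ x)) (fun x hx => ?_) hg τ
  · simpa using this
  · have hx' : v₂ x ≤ v₁ x := by linarith
    have e1 := forcing_sub_forcing_ge (τ := x) hα hκ hε (hlow x) hx'
    have e2 : α ^ 2 ≤ Real.exp (v₂ x) ^ 2 :=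
      pow_le_pow_left₀ hα.le (le_exp_of_log_le hα (hlow x)) 2
    nlinarith [h₁ x, h₂ x]

theorem max_zero_le_abs (τ : ℝ) : max τ 0 ≤ |τ| := max_le (le_abs_self τ) (abs_nonneg τ)

/-- Supersolutions above `log α` lie above solutions. -/
theorem IsSol.le_of_super {α κ ε : ℝ} {v z v₂ z₂ c₂ : ℝ → ℝ} (h : IsSol α κ ε v z) (hα : 0 < α)
    (hκ : 0 ≤ κ) (hε : 0 ≤ ε)
    (hv₂ : ∀ τ, HasDerivAt v₂ (z₂ τ) τ) (hz₂ : ∀ τ, HasDerivAt z₂ (c₂ τ) τ)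
    (h₂ : ∀ τ, c₂ τ ≤ forcing α κ ε τ (v₂ τ))
    (hlow : ∀ τ, Real.log α ≤ v₂ τ) (τ : ℝ) : v τ ≤ v₂ τ := by
  obtain ⟨A, hA⟩ := h.growth
  refine comparison (A := A - Real.log α) (B := 1) hα hκ hε h.hasDerivAt h.hasDerivAt_deriv hv₂ hz₂
    (fun _ => le_rfl) h₂ hlow (fun x => ?_) τ
  linarith [hA x, hlow x, max_zero_le_abs x]

theorem forcing_anti {α κ ε κ' ε' τ v : ℝ} (hκ : κ' ≤ κ) (hε : ε' ≤ ε) :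
    forcing α κ ε τ v ≤ forcing α κ' ε' τ v := by
  simp only [forcing]
  nlinarith [Real.exp_pos (τ - v), Real.exp_pos (2 * (τ - v)),
    mul_nonneg (sub_nonneg.2 hκ) (Real.exp_pos (τ - v)).le,
    mul_nonneg (sub_nonneg.2 hε) (Real.exp_pos (2 * (τ - v))).le]

theorem IsSol.mono {α κ ε κ' ε' : ℝ} {v z v' z' : ℝ → ℝ} (h : IsSol α κ ε v z)
    (h' : IsSol α κ' ε' v' z') (hα : 0 < α) (hκ' : 0 ≤ κ') (hε' : 0 ≤ ε')
    (hκ : κ' ≤ κ) (hε : ε' ≤ ε) (τ : ℝ) : v' τ ≤ v τ :=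
  h'.le_of_super hα hκ' hε' h.hasDerivAt h.hasDerivAt_deriv (fun _ => forcing_anti hκ hε) h.lower τ

theorem IsSol.div_three_le {α κ ε : ℝ} {v z : ℝ → ℝ} (h : IsSol α κ ε v z) (hα : 0 < α)
    (hκ : 1 ≤ κ) (hε : 0 ≤ ε) (τ : ℝ) : τ / 3 ≤ v τ := by
  refine comparison (v₁ := fun τ => τ / 3) (z₁ := fun _ => 1 / 3) (c₁ := fun _ => 0)
    (A := -Real.log α) (B := 1) hα (by linarith) hε
    (fun x => (hasDerivAt_id x).div_const 3) (fun x => hasDerivAt_const x _) h.hasDerivAt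
    h.hasDerivAt_deriv (fun x => ?_) (fun _ => le_rfl) h.lower (fun x => ?_) τ
  · have e : Real.exp (x - x / 3) = Real.exp (2 * (x / 3)) := by congr 1; ring
    simp only [forcing, e]
    nlinarith [Real.exp_pos (x / 3), Real.exp_pos (2 * (x / 3)), Real.exp_pos (2 * (x - x / 3)),
      mul_nonneg (sub_nonneg.2 hκ) (Real.exp_pos (2 * (x / 3))).le,
      mul_nonneg hα.le (Real.exp_pos (x / 3)).le,
      mul_nonneg hε (Real.exp_pos (2 * (x - x / 3))).le]
  · have := h.lower x
    have h1 := le_abs_self x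
    have h2 := abs_nonneg x
    linarith

theorem IsSol.exp_le_cube {α κ ε : ℝ} {v z : ℝ → ℝ} (h : IsSol α κ ε v z) (hα : 0 < α)
    (hκ : 1 ≤ κ) (hε : 0 ≤ ε) (τ : ℝ) : Real.exp τ ≤ Real.exp (v τ) ^ 3 := by
  rw [← Real.exp_nat_mul, Real.exp_le_exp]
  have := h.div_three_le hα hκ hε τ
  push_cast
  linarith

theorem exp_sub_le_div {α v : ℝ} (τ : ℝ) (hα : 0 < α) (h : Real.log α ≤ v) :
    Real.exp (τ - v) ≤ Real.exp τ / α := by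
  rw [Real.exp_sub]
  exact div_le_div_of_nonneg_left (Real.exp_pos τ).le hα (le_exp_of_log_le hα h)

/-- Stability of solutions with respect to the parameters. -/
theorem exists_stability_bound {α : ℝ} (hα : 0 < α) : ∃ K L : ℝ, 0 ≤ K ∧ 0 ≤ L ∧
    ∀ (κ ε κ' ε' δ : ℝ) (v z v' z' : ℝ → ℝ), IsSol α κ ε v z → IsSol α κ' ε' v' z' →
    1 ≤ κ' → κ' ≤ κ → 0 ≤ ε' → ε' ≤ ε → 0 ≤ δ → κ - κ' ≤ δ → ε - ε' ≤ δ →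
    ∀ τ, v τ ≤ v' τ + δ * (K * (L + Real.exp (2 * τ))) := by
  set K : ℝ := 1 / α + 1 / α ^ 2 with hK
  set L : ℝ := (1 + 6 * 729) / α ^ 2 with hL
  have hK0 : 0 < K := by positivity
  have hL0 : 0 < L := by positivity
  refine ⟨K, L, hK0.le, hL0.le, ?_⟩
  intro κ ε κ' ε' δ v z v' z' h h' hκ' hκ hε' hε hδ hδκ hδε τ
  have hd : ∀ x : ℝ, HasDerivAt (fun x : ℝ => δ * (K * (L + Real.exp (2 * x))))
      (δ * (K * (2 * Real.exp (2 * x)))) x := fun x => by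
    have := ((((((hasDerivAt_id x).const_mul 2).exp).const_add L).const_mul K).const_mul δ)
    exact this.congr_deriv (by simp only [id]; ring)
  have hd2 : ∀ x : ℝ, HasDerivAt (fun x : ℝ => δ * (K * (2 * Real.exp (2 * x))))
      (δ * (K * (4 * Real.exp (2 * x)))) x := fun x => by
    have := ((((((hasDerivAt_id x).const_mul 2).exp).const_mul 2).const_mul K).const_mul δ)
    exact this.congr_deriv (by simp only [id]; ring)
  refine h.le_of_super (v₂ := fun x => v' x + δ * (K * (L + Real.exp (2 * x)))) hα (by linarith)
    (by linarith) (fun x => (h'.hasDerivAt x).add (hd x))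
    (fun x => (h'.hasDerivAt_deriv x).add (hd2 x)) (fun x => ?_) (fun x => ?_) τ
  · have hw : 0 ≤ δ * (K * (L + Real.exp (2 * x))) := by positivity
    have e1 := forcing_sub_forcing_ge (τ := x) (v₁ := v' x + δ * (K * (L + Real.exp (2 * x))))
      hα (by linarith : 0 ≤ κ) (by linarith : 0 ≤ ε) (h'.lower x) (by linarith)
    rw [add_sub_cancel_left] at e1
    set s := Real.exp x with hs
    have hs0 : 0 < s := Real.exp_pos x
    have e2x : Real.exp (2 * x) = s ^ 2 := exp_two_mul x
    rw [e2x] at e1 ⊢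
    set X := Real.exp (v' x) with hX
    have hαX : α ≤ X := h'.le_exp hα x
    have hsX : s ≤ X ^ 3 := h'.exp_le_cube hα hκ' hε' x
    have e3 : Real.exp (x - v' x) ≤ s / α := exp_sub_le_div x hα (h'.lower x)
    have e4 : Real.exp (2 * (x - v' x)) ≤ s ^ 2 / α ^ 2 := by
      rw [exp_two_mul, ← div_pow]
      exact pow_le_pow_left₀ (Real.exp_pos _).le e3 2
    have e5 : forcing α κ' ε' x (v' x) ≤ forcing α κ ε x (v' x) + δ * (s / α + s ^ 2 / α ^ 2) := by
      simp only [forcing]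
      have f1 : (κ - κ') * Real.exp (x - v' x) ≤ δ * (s / α) :=
        mul_le_mul hδκ e3 (Real.exp_pos _).le hδ
      have f2 : (ε - ε') * Real.exp (2 * (x - v' x)) ≤ δ * (s ^ 2 / α ^ 2) :=
        mul_le_mul hδε e4 (Real.exp_pos _).le hδ
      linarith
    have e6 : s / α + s ^ 2 / α ^ 2 ≤ K * (1 + 2 * s ^ 2) := by
      have g1 : s / α ≤ 1 / α * (1 + s ^ 2) := by
        rw [div_eq_mul_one_div, mul_comm]
        exact mul_le_mul_of_nonneg_left (by nlinarith [sq_nonneg (s - 1)]) (by positivity)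
      have g2 : s ^ 2 / α ^ 2 = 1 / α ^ 2 * s ^ 2 := by ring
      have g3 : 0 ≤ 1 / α * s ^ 2 := by positivity
      have g4 : 0 ≤ 1 / α ^ 2 * (1 + s ^ 2) := by positivity
      rw [g2, hK]
      linarith
    have e7 : 1 + 6 * s ^ 2 ≤ X ^ 2 * (L + s ^ 2) := by
      by_cases hc : s ≤ 27
      · have : α ^ 2 * L = 1 + 6 * 729 := by rw [hL]; field_simp
        have hXα : α ^ 2 ≤ X ^ 2 := pow_le_pow_left₀ hα.le hαX 2
        have g1 : α ^ 2 * L ≤ X ^ 2 * L := mul_le_mul_of_nonneg_right hXα hL0.le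
        have g2 : 0 ≤ X ^ 2 * s ^ 2 := by positivity
        nlinarith
      · push Not at hc
        have hX3 : 3 < X := by
          by_contra! hX3
          have : X ^ 3 ≤ 3 ^ 3 := pow_le_pow_left₀ (by linarith) hX3 3
          linarith
        have g1 : 0 ≤ X ^ 2 * L := by positivity
        have g2 : 9 * s ^ 2 ≤ X ^ 2 * s ^ 2 := mul_le_mul_of_nonneg_right (by nlinarith) (by positivity)
        nlinarith
    have e8 : δ * (K * (1 + 6 * s ^ 2)) ≤ δ * (K * (X ^ 2 * (L + s ^ 2))) := by gcongr
    have e9 : δ * (s / α + s ^ 2 / α ^ 2) ≤ δ * (K * (1 + 2 * s ^ 2)) := by gcongr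
    nlinarith
  · have : 0 ≤ δ * (K * (L + Real.exp (2 * x))) := by positivity
    linarith [h'.lower x]

theorem abs_forcing_sub_le {α κ ε κ' ε' δ τ v v' : ℝ} (hα : 0 < α) (hκ' : 0 ≤ κ') (hκ : κ' ≤ κ)
    (hε' : 0 ≤ ε') (hε : ε' ≤ ε) (hδκ : κ - κ' ≤ δ) (hδε : ε - ε' ≤ δ)
    (hv' : Real.log α ≤ v') (hv : v' ≤ v) :
    |forcing α κ ε τ v - forcing α κ' ε' τ v'| ≤
      (2 * Real.exp (2 * v) + α * Real.exp v + κ * (Real.exp τ / α)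
        + 2 * ε * (Real.exp τ / α) ^ 2) * (v - v')
      + δ * (Real.exp τ / α + (Real.exp τ / α) ^ 2) := by
  have hw : 0 ≤ v - v' := by linarith
  have hδ : 0 ≤ δ := by linarith
  have a1 := exp_sub_exp_le (2 * v) (2 * v')
  have a2 := exp_sub_exp_le v v'
  have a3 := exp_sub_exp_le (τ - v') (τ - v)
  have a4 := exp_sub_exp_le (2 * (τ - v')) (2 * (τ - v))
  have b1 : Real.exp (2 * v') ≤ Real.exp (2 * v) := Real.exp_le_exp.2 (by linarith)
  have b2 : Real.exp v' ≤ Real.exp v := Real.exp_le_exp.2 (by linarith)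
  have b3 : Real.exp (τ - v) ≤ Real.exp (τ - v') := Real.exp_le_exp.2 (by linarith)
  have b4 : Real.exp (2 * (τ - v)) ≤ Real.exp (2 * (τ - v')) := Real.exp_le_exp.2 (by linarith)
  have e3 : Real.exp (τ - v') ≤ Real.exp τ / α := exp_sub_le_div τ hα hv'
  have e4 : Real.exp (2 * (τ - v')) ≤ (Real.exp τ / α) ^ 2 := by
    rw [exp_two_mul]
    exact pow_le_pow_left₀ (Real.exp_pos _).le e3 2
  set S := Real.exp τ / α
  have hS : 0 < S := by positivity
  have c3 : κ * (Real.exp (τ - v') - Real.exp (τ - v)) ≤ κ * (S * (v - v')) := by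
    refine mul_le_mul_of_nonneg_left (a3.trans ?_) (by linarith)
    rw [show τ - v' - (τ - v) = v - v' by ring]
    gcongr
  have c4 : ε * (Real.exp (2 * (τ - v')) - Real.exp (2 * (τ - v))) ≤ ε * (S ^ 2 * (2 * (v - v'))) := by
    refine mul_le_mul_of_nonneg_left (a4.trans ?_) (by linarith)
    rw [show 2 * (τ - v') - 2 * (τ - v) = 2 * (v - v') by ring]
    gcongr
  have c3' : 0 ≤ κ * (Real.exp (τ - v') - Real.exp (τ - v)) :=
    mul_nonneg (by linarith) (by linarith)
  have c4' : 0 ≤ ε * (Real.exp (2 * (τ - v')) - Real.exp (2 * (τ - v))) :=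
    mul_nonneg (by linarith) (by linarith)
  have c2 : α * (Real.exp v - Real.exp v') ≤ α * (Real.exp v * (v - v')) := by gcongr
  have c2' : 0 ≤ α * (Real.exp v - Real.exp v') := mul_nonneg hα.le (by linarith)
  have d3 : (κ - κ') * Real.exp (τ - v') ≤ δ * S := mul_le_mul hδκ e3 (Real.exp_pos _).le hδ
  have d4 : (ε - ε') * Real.exp (2 * (τ - v')) ≤ δ * S ^ 2 :=
    mul_le_mul hδε e4 (Real.exp_pos _).le hδ
  have d3' : 0 ≤ (κ - κ') * Real.exp (τ - v') := mul_nonneg (by linarith) (Real.exp_pos _).le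
  have d4' : 0 ≤ (ε - ε') * Real.exp (2 * (τ - v')) :=
    mul_nonneg (by linarith) (Real.exp_pos _).le
  have p1 : 0 ≤ Real.exp (2 * v) * (v - v') := by positivity
  have p2 : 0 ≤ α * (Real.exp v * (v - v')) := by positivity
  have p3 : 0 ≤ κ * (S * (v - v')) := le_trans c3' c3
  have p4 : 0 ≤ ε * (S ^ 2 * (2 * (v - v'))) := le_trans c4' c4
  have p5 : 0 ≤ δ * S := by positivity
  have p6 : 0 ≤ δ * S ^ 2 := by positivity
  simp only [forcing]
  rw [abs_le]
  constructor <;> nlinarith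

/-- Locally uniform limits from an explicit Cauchy bound on half-lines. -/
theorem exists_limit_of_cauchy_bound {f : ℕ → ℝ → ℝ} {δ : ℕ → ℝ}
    (hδ : Tendsto δ atTop (𝓝 0))
    (h : ∀ T, ∃ C, ∀ n ≥ 1, ∀ m ≥ n, ∀ τ ≤ T, |f n τ - f m τ| ≤ C * δ n) :
    ∃ g : ℝ → ℝ, TendstoLocallyUniformlyOn f g atTop univ := by
  have hpt : ∀ τ, ∃ l, Tendsto (fun n => f n τ) atTop (𝓝 l) := by
    intro τ
    obtain ⟨C, hC⟩ := h τ
    apply cauchySeq_tendsto_of_complete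
    have hCδ : Tendsto (fun n => C * δ (n + 1)) atTop (𝓝 0) := by
      simpa using (hδ.comp (tendsto_add_atTop_nat 1)).const_mul C
    rw [← cauchySeq_shift 1]
    refine cauchySeq_of_le_tendsto_0' _ (fun n m hnm => ?_) hCδ
    rw [Real.dist_eq]
    exact hC (n + 1) (by omega) (m + 1) (by omega) τ le_rfl
  choose g hg using hpt
  refine ⟨g, ?_⟩
  rw [tendstoLocallyUniformlyOn_iff_forall_isCompact isOpen_univ]
  intro K _ hK
  obtain ⟨T, hT⟩ := hK.bddAbove
  obtain ⟨C, hC⟩ := h T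
  have hb : ∀ n ≥ 1, ∀ τ ∈ K, |f n τ - g τ| ≤ C * δ n := by
    intro n hn τ hτ
    have : Tendsto (fun m => |f n τ - f m τ|) atTop (𝓝 |f n τ - g τ|) :=
      ((hg τ).const_sub _).abs
    exact le_of_tendsto this (by
      filter_upwards [eventually_ge_atTop n] with m hm using hC n hn m hm τ (hT hτ))
  rw [Metric.tendstoUniformlyOn_iff]
  intro ε hε
  have hCδ : Tendsto (fun n => C * δ n) atTop (𝓝 0) := by simpa using hδ.const_mul C
  filter_upwards [hCδ.eventually (gt_mem_nhds hε), eventually_ge_atTop 1] with n hn hn1 τ hτ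
  rw [dist_comm, Real.dist_eq]
  exact (hb n hn1 τ hτ).trans_lt hn

/-- Parameters of the equation for the rescaled finite-`n` functions. -/
noncomputable def kap (α : ℝ) (n : ℕ) : ℝ := 1 + (1 + α) / (2 * n)
noncomputable def eps (n : ℕ) : ℝ := 1 / (4 * (n : ℝ) ^ 2)

/-- The limit equation has a solution, the decreasing limit of the finite-`n` solutions. -/
theorem exists_limit_solution {α : ℝ} (hα : 0 < α) {v z : ℕ → ℝ → ℝ}
    (hsol : ∀ n ≥ 1, IsSol α (kap α n) (eps n) (v n) (z n)) :
    ∃ V Z : ℝ → ℝ, IsSol α 1 0 V Z := by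
  obtain ⟨K, L, hK, hL, hstab⟩ := exists_stability_bound hα
  set δ : ℕ → ℝ := fun n => (1 + α) / (2 * n) + 1 / (4 * (n : ℝ) ^ 2) with hδdef
  have hκ1 : ∀ n, 1 ≤ kap α n := fun n => by simp only [kap]; linarith [show 0 ≤ (1 + α) / (2 * n) by positivity]
  have hε0 : ∀ n, 0 ≤ eps n := fun n => by simp only [eps]; positivity
  have hκm : ∀ n ≥ 1, ∀ m ≥ n, kap α m ≤ kap α n := fun n hn m hm => by
    have : (0:ℝ) < n := by exact_mod_cast hn
    simp only [kap]; gcongr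
  have hεm : ∀ n ≥ 1, ∀ m ≥ n, eps m ≤ eps n := fun n hn m hm => by
    have : (0:ℝ) < n := by exact_mod_cast hn
    simp only [eps]; gcongr
  have hδ0 : ∀ n, 0 ≤ δ n := fun n => by simp only [hδdef]; positivity
  have hδκ : ∀ n m, kap α n - kap α m ≤ δ n := fun n m => by
    simp only [kap, hδdef]
    linarith [show 0 ≤ (1 + α) / (2 * m) by positivity, show 0 ≤ 1 / (4 * (n : ℝ) ^ 2) by positivity]
  have hδε : ∀ n m, eps n - eps m ≤ δ n := fun n m => by
    simp only [eps, hδdef]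
    linarith [show 0 ≤ (1 + α) / (2 * n) by positivity, show 0 ≤ 1 / (4 * (m : ℝ) ^ 2) by positivity]
  have hinv : Tendsto (fun n : ℕ => 1 / (n : ℝ)) atTop (𝓝 0) := tendsto_one_div_atTop_nhds_zero_nat
  have hκlim : Tendsto (kap α) atTop (𝓝 1) := by
    have : Tendsto (fun n : ℕ => 1 + (1 + α) / 2 * (1 / (n : ℝ))) atTop (𝓝 (1 + (1 + α) / 2 * 0)) :=
      (hinv.const_mul _).const_add _
    rw [mul_zero, add_zero] at this
    refine this.congr fun n => ?_
    simp only [kap]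
    ring
  have hεlim : Tendsto eps atTop (𝓝 0) := by
    have : Tendsto (fun n : ℕ => 1 / 4 * (1 / (n : ℝ)) ^ 2) atTop (𝓝 (1 / 4 * 0 ^ 2)) :=
      (hinv.pow 2).const_mul _
    norm_num at this
    refine this.congr fun n => ?_
    simp only [eps]
    ring
  have hδlim : Tendsto δ atTop (𝓝 0) := by
    have := (hκlim.sub_const 1).add hεlim
    rw [sub_self, add_zero] at this
    refine this.congr fun n => ?_
    simp only [kap, eps, hδdef]
    ring
  have hmono : ∀ n ≥ 1, ∀ m ≥ n, ∀ τ, v m τ ≤ v n τ := fun n hn m hm τ =>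
    (hsol n hn).mono (hsol m (hn.trans hm)) hα (by linarith [hκ1 m]) (hε0 m) (hκm n hn m hm)
      (hεm n hn m hm) τ
  have hdiff : ∀ n ≥ 1, ∀ m ≥ n, ∀ τ, v n τ - v m τ ≤ δ n * (K * (L + Real.exp (2 * τ))) :=
    fun n hn m hm τ => by
      have := hstab _ _ _ _ (δ n) _ _ _ _ (hsol n hn) (hsol m (hn.trans hm)) (hκ1 m) (hκm n hn m hm)
        (hε0 m) (hεm n hn m hm) (hδ0 n) (hδκ n m) (hδε n m) τ
      linarith
  have hv : ∀ T, ∃ C, ∀ n ≥ 1, ∀ m ≥ n, ∀ τ ≤ T, |v n τ - v m τ| ≤ C * δ n := by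
    intro T
    refine ⟨K * (L + Real.exp (2 * T)), fun n hn m hm τ hτ => ?_⟩
    rw [abs_of_nonneg (by linarith [hmono n hn m hm τ]), mul_comm]
    refine (hdiff n hn m hm τ).trans ?_
    have := hδ0 n
    gcongr
  obtain ⟨A, hA⟩ := (hsol 1 le_rfl).growth
  have hf : ∀ T, ∃ C, ∀ n ≥ 1, ∀ m ≥ n, ∀ τ ≤ T,
      |forcing α (kap α n) (eps n) τ (v n τ) - forcing α (kap α m) (eps m) τ (v m τ)| ≤ C * δ n := by
    intro T
    set R := A + max T 0
    set S := Real.exp T / α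
    refine ⟨(2 * Real.exp (2 * R) + α * Real.exp R + kap α 1 * S + 2 * eps 1 * S ^ 2) *
      (K * (L + Real.exp (2 * T))) + (S + S ^ 2), fun n hn m hm τ hτ => ?_⟩
    refine (abs_forcing_sub_le hα (by linarith [hκ1 m]) (hκm n hn m hm) (hε0 m) (hεm n hn m hm)
      (hδκ n m) (hδε n m) ((hsol m (hn.trans hm)).lower τ) (hmono n hn m hm τ)).trans ?_
    have h1 : v n τ ≤ R := (hmono 1 le_rfl n hn τ).trans ((hA τ).trans (by
      simp only [R]; gcongr))
    have h2 : v n τ - v m τ ≤ δ n * (K * (L + Real.exp (2 * T))) := by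
      refine (hdiff n hn m hm τ).trans ?_
      have := hδ0 n
      gcongr
    have h3 := hκm 1 le_rfl n hn
    have h4 := hεm 1 le_rfl n hn
    have h5 : Real.exp τ / α ≤ S := by simp only [S]; gcongr
    have h6 : 0 ≤ Real.exp τ / α := by positivity
    have h7 := hκ1 1
    have h8 := hε0 1
    have h9 := hδ0 n
    have h10 := hmono n hn m hm τ
    calc _ ≤ (2 * Real.exp (2 * R) + α * Real.exp R + kap α 1 * S + 2 * eps 1 * S ^ 2) *
          (δ n * (K * (L + Real.exp (2 * T)))) + δ n * (S + S ^ 2) := by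
          gcongr
      _ = _ := by ring
  have hz : ∀ T, ∃ C, ∀ n ≥ 1, ∀ m ≥ n, ∀ τ ≤ T, |z n τ - z m τ| ≤ C * δ n := by
    intro T
    obtain ⟨C₁, h₁⟩ := hv (T + 1)
    obtain ⟨C₂, h₂⟩ := hf (T + 1)
    refine ⟨2 * C₁ + C₂, fun n hn m hm τ hτ => ?_⟩
    have := abs_deriv_le (w := fun τ => v n τ - v m τ) (a := τ)
      (fun x => ((hsol n hn).hasDerivAt x).sub ((hsol m (hn.trans hm)).hasDerivAt x))
      (fun x => ((hsol n hn).hasDerivAt_deriv x).sub ((hsol m (hn.trans hm)).hasDerivAt_deriv x))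
      (fun x hx => h₁ n hn m hm x (by linarith [hx.2]))
      (fun x hx => h₂ n hn m hm x (by linarith [hx.2]))
    linarith
  obtain ⟨V, hV⟩ := exists_limit_of_cauchy_bound hδlim hv
  obtain ⟨Z, hZ⟩ := exists_limit_of_cauchy_bound hδlim hz
  obtain ⟨F, hF⟩ := exists_limit_of_cauchy_bound hδlim hf
  have hVp : ∀ τ, Tendsto (fun n => v n τ) atTop (𝓝 (V τ)) := fun τ => hV.tendsto_at (mem_univ τ)
  have hZp : ∀ τ, Tendsto (fun n => z n τ) atTop (𝓝 (Z τ)) := fun τ => hZ.tendsto_at (mem_univ τ)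
  have hFeq : ∀ τ, F τ = forcing α 1 0 τ (V τ) := by
    intro τ
    refine tendsto_nhds_unique (hF.tendsto_at (mem_univ τ)) ?_
    simp only [forcing]
    have c1 : Continuous Real.exp := Real.continuous_exp
    have t1 := (c1.tendsto _).comp ((hVp τ).const_mul 2)
    have t2 := (c1.tendsto _).comp (hVp τ)
    have t3 := (c1.tendsto _).comp ((hVp τ).const_sub τ)
    have t4 := (c1.tendsto _).comp (((hVp τ).const_sub τ).const_mul 2)
    exact ((t1.sub (t2.const_mul α)).sub (hκlim.mul t3)).sub (hεlim.mul t4)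
  refine ⟨V, Z, fun τ => ?_, fun τ => ?_, fun τ => ?_, A, fun τ => ?_⟩
  · exact hasDerivAt_of_tendstoLocallyUniformlyOn isOpen_univ hZ
      (by filter_upwards [eventually_ge_atTop 1] with n hn x _ using (hsol n hn).hasDerivAt x)
      (fun x _ => hVp x) (mem_univ τ)
  · rw [← hFeq]
    exact hasDerivAt_of_tendstoLocallyUniformlyOn isOpen_univ hF
      (by filter_upwards [eventually_ge_atTop 1] with n hn x _ using (hsol n hn).hasDerivAt_deriv x)
      (fun x _ => hZp x) (mem_univ τ)
  · exact ge_of_tendsto (hVp τ) (by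
      filter_upwards [eventually_ge_atTop 1] with n hn using (hsol n hn).lower τ)
  · exact le_of_tendsto (hVp τ) (by
      filter_upwards [eventually_ge_atTop 1] with n hn using (hmono 1 le_rfl n hn τ).trans (hA τ))

theorem forcing_one_zero (α τ v : ℝ) :
    forcing α 1 0 τ v = Real.exp v ^ 2 - α * Real.exp v - Real.exp τ / Real.exp v := by
  simp only [forcing, exp_two_mul, Real.exp_sub]
  ring

section limit

variable {α : ℝ} {V Z : ℝ → ℝ}

theorem IsSol.le_translate (hV : IsSol α 1 0 V Z) (hα : 0 < α) {h : ℝ} (hh : 0 ≤ h) (τ : ℝ) :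
    V τ ≤ V (τ + h) := by
  refine hV.le_of_super (v₂ := fun τ => V (τ + h)) hα zero_le_one le_rfl
    (fun x => (hV.hasDerivAt (x + h)).comp_add_const x h)
    (fun x => (hV.hasDerivAt_deriv (x + h)).comp_add_const x h) (fun x => ?_)
    (fun x => hV.lower _) τ
  simp only [forcing]
  have : Real.exp (x - V (x + h)) ≤ Real.exp (x + h - V (x + h)) :=
    Real.exp_le_exp.2 (by linarith)
  linarith

theorem IsSol.translate_le (hV : IsSol α 1 0 V Z) (hα : 0 < α) {h : ℝ} (hh : 0 ≤ h) (τ : ℝ) :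
    V (τ + h) ≤ V τ + h / 2 := by
  obtain ⟨A, hA⟩ := hV.growth
  refine comparison (α := α) (κ := Real.exp h) (ε := 0) (v₁ := fun τ => V (τ + h))
    (v₂ := fun τ => V τ + h / 2) (A := A + h - Real.log α) (B := 1)
    hα (Real.exp_pos h).le le_rfl
    (fun x => (hV.hasDerivAt (x + h)).comp_add_const x h)
    (fun x => (hV.hasDerivAt_deriv (x + h)).comp_add_const x h)
    (fun x => (hV.hasDerivAt x).add_const _) hV.hasDerivAt_deriv
    (fun x => ?_) (fun x => ?_) (fun x => ?_) (fun x => ?_) τ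
  · simp only [forcing]
    have : Real.exp (x + h - V (x + h)) = Real.exp h * Real.exp (x - V (x + h)) := by
      rw [← Real.exp_add]; ring_nf
    rw [this]
    linarith
  · have e0 : Real.exp h = Real.exp (h / 2) ^ 2 := by rw [← exp_two_mul]; ring_nf
    have e1 : Real.exp (V x + h / 2) = Real.exp (V x) * Real.exp (h / 2) := Real.exp_add _ _
    rw [forcing_one_zero]
    simp only [forcing, exp_two_mul (V x + h / 2), Real.exp_sub x, e0, e1]
    have hX := hV.le_exp hα x
    have hs := hV.exp_le_cube hα le_rfl le_rfl x
    have hE : 1 ≤ Real.exp (h / 2) := Real.one_le_exp (by linarith)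
    set X := Real.exp (V x)
    set E := Real.exp (h / 2)
    set s := Real.exp x
    have hX0 : 0 < X := by linarith
    have e2 : s / X ≤ X ^ 2 := by rw [div_le_iff₀ hX0]; nlinarith
    have e3 : E ^ 2 * (s / (X * E)) = E * (s / X) := by field_simp
    rw [e3]
    have e4 : 0 ≤ (E - 1) * (X ^ 2 * (E + 1) - α * X - s / X) := by
      refine mul_nonneg (by linarith) ?_
      nlinarith [mul_le_mul_of_nonneg_right hX hX0.le,
        mul_nonneg (show 0 ≤ E - 1 by linarith) (sq_nonneg X)]
    nlinarith
  · linarith [hV.lower x]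
  · have h1 := hA (x + h)
    have h2 : max (x + h) 0 ≤ |x| + h :=
      max_le (by linarith [le_abs_self x]) (by linarith [abs_nonneg x])
    linarith [hV.lower x]

theorem IsSol.deriv_nonneg (hV : IsSol α 1 0 V Z) (hα : 0 < α) (τ : ℝ) : 0 ≤ Z τ := by
  have hm : Monotone V := fun a b hab => by
    have := hV.le_translate hα (sub_nonneg.2 hab) a
    rwa [add_sub_cancel] at this
  rw [← (hV.hasDerivAt τ).deriv]
  exact hm.deriv_nonneg

theorem IsSol.deriv_le_half (hV : IsSol α 1 0 V Z) (hα : 0 < α) (τ : ℝ) : Z τ ≤ 1 / 2 := by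
  have hm : Monotone fun τ => τ / 2 - V τ := fun a b hab => by
    have := hV.translate_le hα (sub_nonneg.2 hab) a
    rw [add_sub_cancel] at this
    simp only
    linarith
  have := hm.deriv_nonneg (x := τ)
  have hd : HasDerivAt (fun τ => τ / 2 - V τ) (1 / 2 - Z τ) τ :=
    ((hasDerivAt_id τ).div_const 2).sub (hV.hasDerivAt τ)
  rw [hd.deriv] at this
  linarith

theorem IsSol.monotone (hV : IsSol α 1 0 V Z) (hα : 0 < α) : Monotone V := by
  refine monotone_of_deriv_nonneg (fun τ => (hV.hasDerivAt τ).differentiableAt) fun τ => ?_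
  rw [(hV.hasDerivAt τ).deriv]
  exact hV.deriv_nonneg hα τ

theorem IsSol.exp_le_add (hV : IsSol α 1 0 V Z) (hα : 0 < α) {M : ℝ} (hαM : α ≤ M) (hM : 1 ≤ M)
    (τ : ℝ) : Real.exp (V τ) ≤ M + Real.exp (τ / 3) := by
  have hy : ∀ x : ℝ, HasDerivAt (fun x : ℝ => M + Real.exp (x / 3)) (Real.exp (x / 3) / 3) x :=
    fun x => (((((hasDerivAt_id x).div_const 3).exp).const_add M)).congr_deriv (by
      simp only [id]; ring)
  have hy' : ∀ x : ℝ, HasDerivAt (fun x : ℝ => Real.exp (x / 3) / 3) (Real.exp (x / 3) / 9) x :=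
    fun x => (((((hasDerivAt_id x).div_const 3).exp).div_const 3)).congr_deriv (by
      simp only [id]; ring)
  have hpos : ∀ x : ℝ, 0 < M + Real.exp (x / 3) := fun x => by positivity
  have key : V τ ≤ Real.log (M + Real.exp (τ / 3)) := by
    refine hV.le_of_super (v₂ := fun x => Real.log (M + Real.exp (x / 3))) hα zero_le_one le_rfl
      (fun x => (hy x).log (hpos x).ne') (fun x => (hy' x).div (hy x) (hpos x).ne')
      (fun x => ?_) (fun x => ?_) τ
    · rw [forcing_one_zero, Real.exp_log (hpos x)]
      have hs : Real.exp x = Real.exp (x / 3) ^ 3 := by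
        rw [← Real.exp_nat_mul]; congr 1; push_cast; ring
      rw [hs]
      set y := Real.exp (x / 3)
      have hy0 : 0 < y := Real.exp_pos _
      have hMy : 0 < M + y := by positivity
      have e1 : y ^ 3 / (M + y) = y ^ 2 - M * y + M ^ 2 * y / (M + y) := by
        field_simp; ring
      have e2 : M ^ 2 * y / (M + y) ≤ M * y := by
        rw [div_le_iff₀ hMy]; nlinarith [mul_pos hy0 hy0]
      have e3 : (y / 9 * (M + y) - y / 3 * (y / 3)) / (M + y) ^ 2 ≤ M * y := by
        rw [div_le_iff₀ (by positivity)]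
        have : 1 ≤ (M + y) ^ 2 := by nlinarith
        have h2 : M * y * 1 ≤ M * y * (M + y) ^ 2 := by gcongr
        nlinarith [mul_pos (by linarith : 0 < M) hy0]
      have e4 : 2 * (M * y) ≤ (M + y) ^ 2 - α * (M + y) - (y ^ 2 - M * y) := by
        nlinarith [mul_le_mul_of_nonneg_right hαM hMy.le]
      linarith
    · exact Real.log_le_log hα (by linarith [Real.exp_pos (x / 3)])
  rwa [Real.le_log_iff_exp_le (hpos τ)] at key

/-- The factor `e^V - α - V'` of the limiting correction is nonnegative. -/
theorem IsSol.deriv_le_exp_sub (hV : IsSol α 1 0 V Z) (hα : 0 < α) (τ : ℝ) :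
    Z τ ≤ Real.exp (V τ) - α := by
  have := nonneg_of_deriv_ge (D := fun τ => Real.exp (V τ) - α - Z τ)
    (c := fun τ => Real.exp (V τ)) (K := 1 / 2) (T := τ) hα (hV.continuous.rexp)
    (hV.le_exp hα)
    (fun x => ((((hV.hasDerivAt x).exp).sub_const α).sub (hV.hasDerivAt_deriv x)))
    (fun x _ => ?_) (fun x _ => ?_) le_rfl
  · linarith
  · rw [forcing_one_zero]
    have : 0 < Real.exp x / Real.exp (V x) := by positivity
    nlinarith
  · linarith [hV.le_exp hα x, hV.deriv_le_half hα x]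

theorem IsSol.exp_sub_sub_le (hV : IsSol α 1 0 V Z) (hα : 0 < α) (τ : ℝ) :
    Real.exp (V τ) - α - Z τ ≤ Real.exp τ / Real.exp (V τ) ^ 2 := by
  have hd : ∀ x, HasDerivAt (fun τ => Real.exp (τ - 2 * V τ))
      (Real.exp (x - 2 * V x) * (1 - 2 * Z x)) x := fun x =>
    ((hasDerivAt_id x).sub ((hV.hasDerivAt x).const_mul 2)).exp
  have heq : ∀ x, Real.exp (x - 2 * V x) = Real.exp x / Real.exp (V x) ^ 2 := fun x => by
    rw [Real.exp_sub, exp_two_mul]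
  have := nonneg_of_deriv_ge (D := fun τ => Real.exp (τ - 2 * V τ) - (Real.exp (V τ) - α - Z τ))
    (c := fun τ => Real.exp (V τ)) (K := Real.exp (V 0)) (T := τ) hα (hV.continuous.rexp)
    (hV.le_exp hα)
    (fun x => (hd x).sub ((((hV.hasDerivAt x).exp).sub_const α).sub (hV.hasDerivAt_deriv x)))
    (fun x _ => ?_) (fun x hx => ?_) le_rfl
  · rw [← heq]; linarith
  · rw [forcing_one_zero]
    have e1 : Real.exp x / Real.exp (V x) = Real.exp (V x) * Real.exp (x - 2 * V x) := by
      rw [heq]; field_simp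
    rw [e1]
    have := hV.deriv_le_half hα x
    nlinarith [mul_nonneg (Real.exp_pos (x - 2 * V x)).le (show 0 ≤ 1 - 2 * Z x by linarith)]
  · have h1 : Real.exp (V x) ≤ Real.exp (V 0) := Real.exp_le_exp.2 (hV.monotone hα hx)
    linarith [Real.exp_pos (x - 2 * V x), hV.deriv_nonneg hα x]

theorem IsSol.tendsto_atBot (hV : IsSol α 1 0 V Z) (hα : 0 < α) :
    Tendsto (fun τ => Real.exp (V τ)) atBot (𝓝 α) := by
  have hmono : Monotone fun τ => Real.exp (V τ) := fun a b hab =>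
    Real.exp_le_exp.2 (hV.monotone hα hab)
  rw [tendsto_order]
  refine ⟨fun a ha => Eventually.of_forall fun τ => ha.trans_le (hV.le_exp hα τ), fun b hb => ?_⟩
  by_cases hex : ∃ τ₁, Real.exp (V τ₁) < b
  · obtain ⟨τ₁, h₁⟩ := hex
    filter_upwards [eventually_le_atBot τ₁] with τ hτ using (hmono hτ).trans_lt h₁
  · exfalso
    push Not at hex
    set k := b * (b - α) / 2 with hk
    have hk0 : 0 < k := by
      have : 0 < b := by linarith
      have : 0 < b - α := by linarith
      positivity
    have hZ' : ∀ x ≤ Real.log (α * k), k ≤ forcing α 1 0 x (V x) := by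
      intro x hx
      rw [forcing_one_zero]
      have h1 : Real.exp x ≤ α * k := by
        rwa [← Real.le_log_iff_exp_le (by positivity)]
      have h2 : Real.exp x / Real.exp (V x) ≤ k := by
        rw [div_le_iff₀ (Real.exp_pos _)]
        nlinarith [hV.le_exp hα x]
      have h3 := hex x
      have h4 : b * (b - α) ≤ Real.exp (V x) * (Real.exp (V x) - α) := by
        apply mul_le_mul h3 (by linarith) (by linarith) (Real.exp_pos _).le
      nlinarith
    set T := Real.log (α * k)
    have hd : ∀ x, HasDerivAt (fun x => Z x - k * x) (forcing α 1 0 x (V x) - k * 1) x :=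
      fun x => (hV.hasDerivAt_deriv x).sub ((hasDerivAt_id x).const_mul k)
    have hm : MonotoneOn (fun x => Z x - k * x) (Iic T) := by
      apply monotoneOn_of_deriv_nonneg (convex_Iic T)
      · exact fun x _ => (hd x).continuousAt.continuousWithinAt
      · exact fun x _ => (hd x).differentiableAt.differentiableWithinAt
      · intro x hx
        rw [interior_Iic] at hx
        rw [(hd x).deriv]
        have := hZ' x (le_of_lt hx)
        linarith
    have h1 := hm (show T - 1 / k ≤ T by linarith [show 0 < 1 / k by positivity])
      (show T ≤ T from le_rfl) (by linarith [show 0 < 1 / k by positivity])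
    have h2 := hV.deriv_nonneg hα (T - 1 / k)
    have h3 := hV.deriv_le_half hα T
    have h4 : k * (T - 1 / k) = k * T - 1 := by field_simp
    simp only [h4] at h1
    linarith

theorem IsSol.contDiff (hV : IsSol α 1 0 V Z) : ContDiff ℝ (⊤ : ℕ∞) V := by
  have key : ∀ n : ℕ, ContDiff ℝ n V ∧ ContDiff ℝ n Z := by
    intro n
    induction n with
    | zero =>
      refine ⟨contDiff_zero.2 hV.continuous, contDiff_zero.2 ?_⟩
      exact continuous_iff_continuousAt.2 fun τ => (hV.hasDerivAt_deriv τ).continuousAt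
    | succ n ih =>
      have hdV : deriv V = Z := funext fun τ => (hV.hasDerivAt τ).deriv
      have hdZ : deriv Z = fun τ => forcing α 1 0 τ (V τ) :=
        funext fun τ => (hV.hasDerivAt_deriv τ).deriv
      refine ⟨?_, ?_⟩
      · push_cast
        rw [contDiff_succ_iff_deriv]
        refine ⟨fun τ => (hV.hasDerivAt τ).differentiableAt, by simp, hdV ▸ ih.2⟩
      · push_cast
        rw [contDiff_succ_iff_deriv]
        refine ⟨fun τ => (hV.hasDerivAt_deriv τ).differentiableAt, by simp, ?_⟩
        rw [hdZ]
        have := ih.1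
        unfold forcing
        fun_prop
  exact contDiff_infty.2 fun n => (key n).1

end limit

/-- The solution of the third-order equation attached to the logarithmic profile `V` with
derivative `Z`. -/
noncomputable def profile (α : ℝ) (V Z : ℝ → ℝ) (s : ℝ) : ℝ :=
  (Real.exp (V (Real.log s)) ^ 2 - 2 * α * Real.exp (V (Real.log s)) + 1 / 4
    + 2 * (s / Real.exp (V (Real.log s))) - Z (Real.log s) ^ 2) / 2

section profile

variable {α : ℝ} {V Z : ℝ → ℝ}

theorem IsSol.hasDerivAt_profile (hV : IsSol α 1 0 V Z) {s : ℝ} (hs : 0 < s) :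
    HasDerivAt (profile α V Z) (Real.exp (-V (Real.log s))) s := by
  have hx : HasDerivAt (fun s => Real.exp (V (Real.log s)))
      (Real.exp (V (Real.log s)) * (Z (Real.log s) * s⁻¹)) s :=
    ((hV.hasDerivAt (Real.log s)).comp s (Real.hasDerivAt_log hs.ne')).exp
  have hz : HasDerivAt (fun s => Z (Real.log s))
      (forcing α 1 0 (Real.log s) (V (Real.log s)) * s⁻¹) s :=
    (hV.hasDerivAt_deriv (Real.log s)).comp s (Real.hasDerivAt_log hs.ne')
  have hx0 : Real.exp (V (Real.log s)) ≠ 0 := (Real.exp_pos _).ne'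
  have := ((((((hx.pow 2).sub (hx.const_mul (2 * α))).add_const (1 / 4 : ℝ)).add
    (((hasDerivAt_id s).div hx hx0).const_mul 2)).sub (hz.pow 2))).div_const 2
  refine this.congr_deriv ?_
  rw [forcing_one_zero, Real.exp_log hs, Real.exp_neg]
  simp only [id]
  have := hs.ne'
  field_simp
  push_cast
  ring

theorem IsSol.deriv_profile (hV : IsSol α 1 0 V Z) {s : ℝ} (hs : 0 < s) :
    deriv (profile α V Z) s = Real.exp (-V (Real.log s)) := (hV.hasDerivAt_profile hs).deriv

theorem IsSol.contDiffAt_profile (hV : IsSol α 1 0 V Z) {s : ℝ} (hs : 0 < s) :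
    ContDiffAt ℝ (⊤ : ℕ∞) (profile α V Z) s := by
  have hlog : ContDiffAt ℝ (⊤ : ℕ∞) Real.log s := Real.contDiffAt_log.2 hs.ne'
  have hVl : ContDiffAt ℝ (⊤ : ℕ∞) (fun s => V (Real.log s)) s :=
    hV.contDiff.contDiffAt.comp s hlog
  have hdV : deriv V = Z := funext fun τ => (hV.hasDerivAt τ).deriv
  have hZ : ContDiff ℝ (⊤ : ℕ∞) Z := hdV ▸ (contDiff_infty_iff_deriv.1 hV.contDiff).2
  have hZl : ContDiffAt ℝ (⊤ : ℕ∞) (fun s => Z (Real.log s)) s := hZ.contDiffAt.comp s hlog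
  have hx := hVl.exp
  exact (((((hx.pow 2).sub (contDiffAt_const.mul hx)).add contDiffAt_const).add
    (contDiffAt_const.mul (contDiffAt_id.div hx (Real.exp_pos _).ne'))).sub
    (hZl.pow 2)).div_const 2

theorem IsSol.profile_ode (hV : IsSol α 1 0 V Z) {s : ℝ} (hs : 0 < s) :
    2 * s ^ 2 * deriv (profile α V Z) s * deriv (deriv (deriv (profile α V Z))) s
      - s ^ 2 * (deriv (deriv (profile α V Z)) s) ^ 2
      + 2 * s * deriv (profile α V Z) s * deriv (deriv (profile α V Z)) s
      - 4 * s * (deriv (profile α V Z) s) ^ 3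
      + (2 * profile α V Z s - 1 / 4) * (deriv (profile α V Z) s) ^ 2 + 1 = 0 := by
  have h1 : ∀ s : ℝ, 0 < s → deriv (profile α V Z) s = Real.exp (-V (Real.log s)) :=
    fun s hs => hV.deriv_profile hs
  have hd : ∀ s : ℝ, 0 < s → HasDerivAt (fun s => Real.exp (-V (Real.log s)))
      (Real.exp (-V (Real.log s)) * -(Z (Real.log s) * s⁻¹)) s := fun s hs =>
    ((hV.hasDerivAt (Real.log s)).comp s (Real.hasDerivAt_log hs.ne')).neg.exp
  have h2 : ∀ s : ℝ, 0 < s → deriv (deriv (profile α V Z)) s =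
      Real.exp (-V (Real.log s)) * -(Z (Real.log s) * s⁻¹) := fun s hs => by
    have : deriv (profile α V Z) =ᶠ[𝓝 s] fun s => Real.exp (-V (Real.log s)) :=
      (eventually_gt_nhds hs).mono h1
    rw [this.deriv_eq, (hd s hs).deriv]
  have h3 : deriv (deriv (deriv (profile α V Z))) s = Real.exp (-V (Real.log s)) *
      (Z (Real.log s) ^ 2 + Z (Real.log s)
        - forcing α 1 0 (Real.log s) (V (Real.log s))) / s ^ 2 := by
    have : deriv (deriv (profile α V Z)) =ᶠ[𝓝 s]
        fun s => Real.exp (-V (Real.log s)) * -(Z (Real.log s) * s⁻¹) :=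
      (eventually_gt_nhds hs).mono h2
    rw [this.deriv_eq]
    have hz : HasDerivAt (fun s => Z (Real.log s))
        (forcing α 1 0 (Real.log s) (V (Real.log s)) * s⁻¹) s :=
      (hV.hasDerivAt_deriv (Real.log s)).comp s (Real.hasDerivAt_log hs.ne')
    rw [((hd s hs).fun_mul (hz.fun_mul (hasDerivAt_inv hs.ne')).fun_neg).deriv]
    have := hs.ne'
    field_simp
    ring
  rw [h1 s hs, h2 s hs, h3, forcing_one_zero, profile, Real.exp_log hs, Real.exp_neg]
  have := hs.ne'
  have hx0 : Real.exp (V (Real.log s)) ≠ 0 := (Real.exp_pos _).ne'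
  field_simp
  ring

theorem IsSol.tendsto_profile (hV : IsSol α 1 0 V Z) (hα : 0 < α) :
    Tendsto (profile α V Z) (𝓝[>] (0 : ℝ)) (𝓝 ((1 - 4 * α ^ 2) / 8)) := by
  have hlog : Tendsto Real.log (𝓝[>] (0 : ℝ)) atBot := Real.tendsto_log_nhdsGT_zero
  have hx := (hV.tendsto_atBot hα).comp hlog
  have hz : Tendsto (fun s => Z (Real.log s)) (𝓝[>] (0 : ℝ)) (𝓝 0) := by
    refine squeeze_zero (fun s => hV.deriv_nonneg hα _) (fun s => hV.deriv_le_exp_sub hα _) ?_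
    simpa using hx.sub_const α
  have hs : Tendsto (fun s : ℝ => s) (𝓝[>] (0 : ℝ)) (𝓝 0) := nhdsWithin_le_nhds
  have := (((((hx.pow 2).sub (hx.const_mul (2 * α))).add_const (1 / 4 : ℝ)).add
    ((hs.div hx hα.ne').const_mul 2)).sub (hz.pow 2)).div_const 2
  have he : (1 - 4 * α ^ 2) / 8 = (α ^ 2 - 2 * α * α + 1 / 4 + 2 * (0 / α) - 0 ^ 2) / 2 := by
    ring
  rw [he]
  exact this

theorem IsSol.abs_profile_sub_le (hV : IsSol α 1 0 V Z) (hα : 0 < α) {s : ℝ} (hs : 0 < s) :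
    |profile α V Z s - ((3 / 2) * s ^ ((2 : ℝ) / 3) - α * s ^ ((1 : ℝ) / 3))| ≤
      2 * max α 1 ^ 2 + α * max α 1 + 1 := by
  set M := max α 1 with hM
  have h1 := hV.exp_le_add hα (le_max_left α 1) (le_max_right α 1) (Real.log s)
  have h2 := hV.exp_le_cube hα le_rfl le_rfl (Real.log s)
  have hz0 := hV.deriv_nonneg hα (Real.log s)
  have hz1 := hV.deriv_le_half hα (Real.log s)
  have hx0 : 0 < Real.exp (V (Real.log s)) := Real.exp_pos _
  have hy : Real.exp (Real.log s / 3) = s ^ ((1 : ℝ) / 3) := by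
    rw [Real.rpow_def_of_pos hs]; ring_nf
  have hy2 : s ^ ((2 : ℝ) / 3) = (s ^ ((1 : ℝ) / 3)) ^ 2 := by
    rw [← Real.rpow_natCast, ← Real.rpow_mul hs.le]; norm_num
  have hy3 : s = (s ^ ((1 : ℝ) / 3)) ^ 3 := by
    rw [← Real.rpow_natCast, ← Real.rpow_mul hs.le]; norm_num
  rw [hy] at h1
  rw [Real.exp_log hs] at h2
  rw [hy2, profile]
  set y := s ^ ((1 : ℝ) / 3)
  set x := Real.exp (V (Real.log s))
  set z := Z (Real.log s)
  have hy0 : 0 < y := Real.rpow_pos_of_pos hs _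
  rw [hy3] at h2
  have hyx : y ≤ x := le_of_pow_le_pow_left₀ (by norm_num) hx0.le h2
  have hkey : x ^ 2 + 2 * (s / x) - 3 * y ^ 2 = (x - y) ^ 2 * ((x + 2 * y) / x) := by
    rw [hy3]; field_simp; ring
  have hr1 : (x + 2 * y) / x ≤ 3 := by rw [div_le_iff₀ hx0]; linarith
  have hr0 : 0 ≤ (x + 2 * y) / x := by positivity
  have hM0 : 1 ≤ M := le_max_right _ _
  have hsq : (x - y) ^ 2 ≤ M ^ 2 := pow_le_pow_left₀ (by linarith) (by linarith) 2
  have hb1 : (x - y) ^ 2 * ((x + 2 * y) / x) ≤ M ^ 2 * 3 := by gcongr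
  have hb0 : 0 ≤ (x - y) ^ 2 * ((x + 2 * y) / x) := by positivity
  have hb2 : α * (x - y) ≤ α * M := by gcongr; linarith
  have hb3 : 0 ≤ α * (x - y) := by apply mul_nonneg hα.le; linarith
  have hz2 : z ^ 2 ≤ 1 := by nlinarith
  have hM2 := sq_nonneg M
  rw [abs_le]
  constructor <;> nlinarith

end profile

section moment

variable {a t x : ℝ}

theorem pertLagWeight_nonneg (a t : ℝ) {x : ℝ} (hx : 0 ≤ x) : 0 ≤ pertLagWeight a t x :=
  mul_nonneg (Real.rpow_nonneg hx _) (Real.exp_nonneg _)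

theorem measurable_pertLagWeight (a t : ℝ) : Measurable (pertLagWeight a t) := by
  unfold pertLagWeight
  fun_prop

theorem pertLagWeight_anti {t t' : ℝ} (h : t ≤ t') (hx : 0 < x) :
    pertLagWeight a t' x ≤ pertLagWeight a t x := by
  unfold pertLagWeight
  have : t / x ≤ t' / x := by gcongr
  gcongr

theorem integrableOn_pertLagWeight (a : ℝ) (ht : 0 < t) :
    IntegrableOn (pertLagWeight a t) (Ioi 0) := by
  obtain ⟨k, hk⟩ := exists_nat_gt (-a)
  have hg := (Real.GammaIntegral_convergent (s := a + k + 1) (by linarith [hk])).const_mul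
    (k.factorial / t ^ k : ℝ)
  refine Integrable.mono' hg (measurable_pertLagWeight a t).aestronglyMeasurable ?_
  filter_upwards [ae_restrict_mem measurableSet_Ioi] with x hx
  have hx : 0 < x := hx
  rw [Real.norm_of_nonneg (pertLagWeight_nonneg a t hx.le), pertLagWeight]
  have h1 := Real.pow_div_factorial_le_exp (t / x) (by positivity) k
  have h2 : Real.exp (-(t / x)) ≤ k.factorial / t ^ k * x ^ k := by
    rw [Real.exp_neg, inv_le_comm₀ (Real.exp_pos _) (by positivity)]
    refine le_trans (le_of_eq ?_) h1
    rw [div_pow]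
    field_simp
  have h3 : a + k + 1 - 1 = a + k := by ring
  calc x ^ a * Real.exp (-x - t / x) = x ^ a * Real.exp (-x) * Real.exp (-(t / x)) := by
        rw [sub_eq_add_neg, Real.exp_add]; ring
    _ ≤ x ^ a * Real.exp (-x) * (k.factorial / t ^ k * x ^ k) := by gcongr
    _ = _ := by rw [h3, Real.rpow_add hx, Real.rpow_natCast]; ring

/-- Moments of the perturbed Laguerre weight. -/
noncomputable def moment (a t : ℝ) : ℝ := ∫ x in Ioi (0 : ℝ), pertLagWeight a t x

theorem hasDerivAt_moment (a : ℝ) (ht : 0 < t) :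
    HasDerivAt (moment a) (-moment (a - 1) t) t := by
  have key := (hasDerivAt_integral_of_dominated_loc_of_deriv_le
    (μ := volume.restrict (Ioi (0 : ℝ))) (F := pertLagWeight a)
    (F' := fun t x => -pertLagWeight (a - 1) t x) (s := Ioi (t / 2))
    (bound := pertLagWeight (a - 1) (t / 2)) (Ioi_mem_nhds (half_lt_self ht))
    (Eventually.of_forall fun t => (measurable_pertLagWeight a t).aestronglyMeasurable)
    (integrableOn_pertLagWeight a ht)
    (measurable_pertLagWeight (a - 1) t).neg.aestronglyMeasurable ?_
    (integrableOn_pertLagWeight (a - 1) (half_pos ht)) ?_).2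
  · rwa [integral_neg] at key
  · filter_upwards [ae_restrict_mem measurableSet_Ioi] with x hx y hy
    rw [norm_neg, Real.norm_of_nonneg (pertLagWeight_nonneg _ _ (le_of_lt hx))]
    exact pertLagWeight_anti (le_of_lt hy) hx
  · filter_upwards [ae_restrict_mem measurableSet_Ioi] with x hx y hy
    have hx : 0 < x := hx
    have hd : HasDerivAt (fun y => pertLagWeight a y x)
        (x ^ a * (Real.exp (-x - y / x) * (-(1 / x)))) y :=
      ((((hasDerivAt_id y).div_const x).const_sub (-x)).exp).const_mul (x ^ a)
    refine hd.congr_deriv ?_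
    rw [pertLagWeight, Real.rpow_sub_one hx.ne']
    ring

theorem moment_recurrence (a : ℝ) (ht : 0 < t) :
    a * moment (a - 1) t - moment a t + t * moment (a - 2) t = 0 := by
  have heq : ∀ x ∈ Ioi (0 : ℝ), a * x ^ (a - 1) * Real.exp (-x - t / x) +
      x ^ a * (Real.exp (-x - t / x) * (-1 - t * (-(x ^ 2)⁻¹))) =
      a * pertLagWeight (a - 1) t x - pertLagWeight a t x + t * pertLagWeight (a - 2) t x := by
    intro x hx
    have hx : 0 < x := hx
    have h2 : x ^ (a - 2) = x ^ a / x ^ 2 := by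
      rw [Real.rpow_sub hx, Real.rpow_two]
    rw [pertLagWeight, pertLagWeight, pertLagWeight, h2]
    ring
  have h0 := integrableOn_pertLagWeight a ht
  have h1 := integrableOn_pertLagWeight (a - 1) ht
  have h2 := integrableOn_pertLagWeight (a - 2) ht
  have key := integral_Ioi_deriv_mul_eq_sub (a := 0) (a' := (0 : ℝ)) (b' := 0)
    (u := fun x : ℝ => x ^ a) (u' := fun x : ℝ => a * x ^ (a - 1))
    (v := fun x => Real.exp (-x - t / x))
    (v' := fun x => Real.exp (-x - t / x) * (-1 - t * (-(x ^ 2)⁻¹)))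
    (fun x hx => Real.hasDerivAt_rpow_const (Or.inl (ne_of_gt hx)))
    (fun x hx => ?_) ?_ ?_ ?_
  · rw [setIntegral_congr_fun measurableSet_Ioi heq, integral_add, integral_sub,
      integral_const_mul, integral_const_mul, sub_zero] at key
    · exact key
    · exact h1.const_mul a
    · exact h0
    · exact (h1.const_mul a).sub h0
    · exact h2.const_mul t
  · have hx0 : x ≠ 0 := ne_of_gt hx
    have hd : HasDerivAt (fun x : ℝ => -x - t * x⁻¹) (-1 - t * (-(x ^ 2)⁻¹)) x :=
      (hasDerivAt_id x).neg.sub ((hasDerivAt_inv hx0).const_mul t)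
    simpa only [div_eq_mul_inv] using hd.exp
  · exact IntegrableOn.congr_fun (((h1.const_mul a).sub h0).add (h2.const_mul t))
      (fun x hx => (heq x hx).symm) measurableSet_Ioi
  · have h := (tendsto_rpow_mul_exp_neg_mul_atTop_nhds_zero (-a) t ht).comp
      tendsto_inv_nhdsGT_zero
    refine squeeze_zero' ?_ ?_ h
    · filter_upwards [self_mem_nhdsWithin] with x hx
      exact pertLagWeight_nonneg a t (le_of_lt hx)
    · filter_upwards [self_mem_nhdsWithin] with x hx
      have hx : 0 < x := hx
      simp only [Function.comp, Pi.mul_apply]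
      rw [Real.inv_rpow hx.le, Real.rpow_neg hx.le, inv_inv]
      gcongr
      have : -t * x⁻¹ = -(t / x) := by ring
      linarith
  · have h := tendsto_rpow_mul_exp_neg_mul_atTop_nhds_zero a 1 one_pos
    refine squeeze_zero' ?_ ?_ h
    · filter_upwards [eventually_gt_atTop 0] with x hx
      exact pertLagWeight_nonneg a t (le_of_lt hx)
    · filter_upwards [eventually_gt_atTop 0] with x hx
      simp only [Pi.mul_apply]
      gcongr
      have : 0 ≤ t / x := by positivity
      linarith

end moment

open Polynomial in
/-- The linear functional `q ↦ ∫ q(x) w(x; t, a) dx` on polynomials, defined through moments. -/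
noncomputable def momentFunctional (a t : ℝ) : ℝ[X] →ₗ[ℝ] ℝ :=
  Polynomial.lsum fun i => moment (a + i) t • LinearMap.id

section functional

open Polynomial

variable {a t : ℝ}

theorem momentFunctional_monomial (a t : ℝ) (i : ℕ) (c : ℝ) :
    momentFunctional a t (monomial i c) = moment (a + i) t * c := by
  simp [momentFunctional, Polynomial.lsum_apply, sum_monomial_index]

theorem momentFunctional_C_mul (a t c : ℝ) (q : ℝ[X]) :
    momentFunctional a t (C c * q) = c * momentFunctional a t q := by
  rw [← smul_eq_C_mul, map_smul, smul_eq_mul]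

theorem momentFunctional_X_mul (a t : ℝ) (q : ℝ[X]) :
    momentFunctional a t (X * q) = momentFunctional (a + 1) t q := by
  induction q using Polynomial.induction_on' with
  | add p q hp hq => rw [mul_add, map_add, map_add, hp, hq]
  | monomial i c =>
    rw [X_mul_monomial, momentFunctional_monomial, momentFunctional_monomial]
    push_cast
    ring_nf

theorem momentFunctional_derivative (a : ℝ) (ht : 0 < t) (q : ℝ[X]) :
    momentFunctional a t (derivative q) + a * momentFunctional (a - 1) t q
      - momentFunctional a t q + t * momentFunctional (a - 2) t q = 0 := by
  induction q using Polynomial.induction_on' with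
  | add p q hp hq =>
    simp only [map_add]
    linarith
  | monomial i c =>
    have h := moment_recurrence (a + i) ht
    rw [derivative_monomial]
    simp only [momentFunctional_monomial]
    have e1 : a - 1 + i = a + i - 1 := by ring
    have e2 : a - 2 + i = a + i - 2 := by ring
    rw [e1, e2]
    rcases i with _ | i
    · simp only [Nat.cast_zero, add_zero, mul_zero] at h ⊢
      linear_combination c * h
    · have e3 : a + ((i + 1 - 1 : ℕ) : ℝ) = a + ((i + 1 : ℕ) : ℝ) - 1 := by
        push_cast [Nat.add_sub_cancel]; ring
      rw [e3]
      linear_combination c * h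

theorem integrableOn_eval_mul (a : ℝ) (ht : 0 < t) (q : ℝ[X]) :
    IntegrableOn (fun x => q.eval x * pertLagWeight a t x) (Ioi 0) ∧
      ∫ x in Ioi (0 : ℝ), q.eval x * pertLagWeight a t x = momentFunctional a t q := by
  induction q using Polynomial.induction_on' with
  | add p q hp hq =>
    simp only [eval_add, add_mul, map_add]
    exact ⟨hp.1.add hq.1, by rw [integral_add hp.1 hq.1, hp.2, hq.2]⟩
  | monomial i c =>
    have heq : ∀ x ∈ Ioi (0 : ℝ), c * pertLagWeight (a + i) t x =
        (monomial i c).eval x * pertLagWeight a t x := by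
      intro x hx
      have hx : 0 < x := hx
      rw [eval_monomial, pertLagWeight, pertLagWeight, Real.rpow_add hx, Real.rpow_natCast]
      ring
    refine ⟨IntegrableOn.congr_fun ((integrableOn_pertLagWeight (a + i) ht).const_mul c) heq
      measurableSet_Ioi, ?_⟩
    rw [← setIntegral_congr_fun measurableSet_Ioi heq, integral_const_mul,
      momentFunctional_monomial, moment, mul_comm]

theorem momentFunctional_mul_self_nonneg (a : ℝ) (ht : 0 < t) (q : ℝ[X]) :
    0 ≤ momentFunctional a t (q * q) := by
  rw [← (integrableOn_eval_mul a ht _).2]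
  refine setIntegral_nonneg measurableSet_Ioi fun x hx => ?_
  rw [eval_mul]
  exact mul_nonneg (mul_self_nonneg _) (pertLagWeight_nonneg a t (le_of_lt hx))

theorem momentFunctional_eq_sum (a t : ℝ) {q : ℝ[X]} {D : ℕ} (hq : q.natDegree < D) :
    momentFunctional a t q = ∑ i ∈ Finset.range D, moment (a + i) t * q.coeff i := by
  rw [momentFunctional, Polynomial.lsum_apply, sum_over_range' _ _ D hq]
  · rfl
  · simp

end functional

open Polynomial in
/-- Monic orthogonal polynomials for the weight `w(x; t, α)` at a fixed time, with squared norms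
`h` and recurrence coefficients `A`, `B`. -/
structure IsOrtho (α t : ℝ) (p : ℕ → ℝ[X]) (h A B : ℕ → ℝ) : Prop where
  monic : ∀ m, (p m).Monic
  natDegree : ∀ m, (p m).natDegree = m
  orth : ∀ j k, momentFunctional α t (p j * p k) = if j = k then h j else 0
  pos : ∀ m, 0 < h m
  recur : ∀ m, 1 ≤ m → X * p m = p (m + 1) + C (A m) * p m + C (B m) * p (m - 1)

section ortho

open Polynomial

variable {α t : ℝ} {p : ℕ → ℝ[X]} {h A B : ℕ → ℝ}

theorem IsOrtho.coeff_self (O : IsOrtho α t p h A B) (m : ℕ) : (p m).coeff m = 1 := by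
  have := O.monic m
  rwa [Monic, leadingCoeff, O.natDegree] at this

theorem IsOrtho.coeff_eq_zero (O : IsOrtho α t p h A B) {m k : ℕ} (hk : m < k) :
    (p m).coeff k = 0 := coeff_eq_zero_of_natDegree_lt (by rwa [O.natDegree])

theorem IsOrtho.apply_mul (O : IsOrtho α t p h A B) {m : ℕ} {q : ℝ[X]} (hq : q.natDegree ≤ m) :
    momentFunctional α t (p m * q) = q.coeff m * h m := by
  have key : ∀ d ≤ m + 1, ∀ q : ℝ[X], (∀ k, d ≤ k → q.coeff k = 0) →
      momentFunctional α t (p m * q) = q.coeff m * h m := by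
    intro d
    induction d with
    | zero =>
      intro _ q hq
      have : q = 0 := by ext k; simpa using hq k (Nat.zero_le k)
      simp [this]
    | succ d ih =>
      intro hd q hq
      have hq' := ih (by omega) (q - C (q.coeff d) * p d) (fun k hk => by
        rw [coeff_sub, coeff_C_mul]
        rcases hk.eq_or_lt with rfl | hk
        · rw [O.coeff_self]; ring
        · rw [O.coeff_eq_zero hk, hq k hk]; ring)
      rw [mul_sub, map_sub, mul_left_comm, momentFunctional_C_mul, O.orth, coeff_sub,
        coeff_C_mul] at hq'
      rcases (Nat.lt_succ_iff.1 hd).eq_or_lt with rfl | hlt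
      · rw [if_pos rfl, O.coeff_self] at hq'
        linarith
      · rw [if_neg hlt.ne', O.coeff_eq_zero hlt] at hq'
        linarith
  exact key (m + 1) le_rfl q fun k hk => coeff_eq_zero_of_natDegree_lt (by omega)

theorem momentFunctional_divX (a t : ℝ) (r q : ℝ[X]) :
    momentFunctional (a - 1) t (r * q) =
      q.coeff 0 * momentFunctional (a - 1) t r + momentFunctional a t (r * q.divX) := by
  have h1 : r * q = X * (r * q.divX) + C (q.coeff 0) * r := by
    conv_lhs => rw [← divX_mul_X_add q]
    ring
  rw [h1, map_add, momentFunctional_X_mul, momentFunctional_C_mul, sub_add_cancel]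
  ring

theorem IsOrtho.apply_mul_sub_one (O : IsOrtho α t p h A B) {m : ℕ} {q : ℝ[X]}
    (hq : q.natDegree ≤ m + 1) :
    momentFunctional (α - 1) t (p m * q) =
      q.coeff 0 * momentFunctional (α - 1) t (p m) + q.coeff (m + 1) * h m := by
  rw [momentFunctional_divX, O.apply_mul, coeff_divX]
  rw [natDegree_divX_eq_natDegree_tsub_one]
  omega

theorem IsOrtho.apply_mul_sub_two (O : IsOrtho α t p h A B) {m : ℕ} {q : ℝ[X]}
    (hq : q.natDegree ≤ m + 1) :
    momentFunctional (α - 2) t (p m * q) =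
      q.coeff 0 * momentFunctional (α - 2) t (p m) +
        q.coeff 1 * momentFunctional (α - 1) t (p m) := by
  have e : α - 2 = α - 1 - 1 := by ring
  rw [e, momentFunctional_divX, O.apply_mul_sub_one, coeff_divX, coeff_divX,
    coeff_eq_zero_of_natDegree_lt (p := q) (n := m + 1 + 1) (by omega)]
  · ring
  · rw [natDegree_divX_eq_natDegree_tsub_one]
    omega

variable (α t p h) in
/-- The auxiliary quantity `(t / h_m) ∫ p_m² w / x`. -/
noncomputable def auxDiag (m : ℕ) : ℝ := t * momentFunctional (α - 1) t (p m * p m) / h m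

variable (α t p h) in
/-- The auxiliary quantity `(t / h_m) ∫ p_{m+1} p_m w / x`. -/
noncomputable def auxOff (m : ℕ) : ℝ := t * momentFunctional (α - 1) t (p (m + 1) * p m) / h m

theorem IsOrtho.A_eq_coeff (O : IsOrtho α t p h A B) (n : ℕ) :
    A (n + 1) = (p (n + 1)).coeff n - (p (n + 2)).coeff (n + 1) := by
  have := congrArg (fun q => q.coeff (n + 1)) (O.recur (n + 1) (by omega))
  simp only [coeff_X_mul, coeff_add, coeff_C_mul, O.coeff_self, Nat.add_sub_cancel] at this
  rw [O.coeff_eq_zero (Nat.lt_succ_self n)] at this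
  linarith

theorem IsOrtho.apply_X_mul_self (O : IsOrtho α t p h A B) (n : ℕ) :
    momentFunctional (α + 1) t (p (n + 1) * p (n + 1)) = A (n + 1) * h (n + 1) := by
  have e : X * (p (n + 1) * p (n + 1)) = p (n + 1) * p (n + 2) +
      C (A (n + 1)) * (p (n + 1) * p (n + 1)) + C (B (n + 1)) * (p (n + 1) * p n) := by
    have := O.recur (n + 1) (by omega)
    rw [Nat.add_sub_cancel] at this
    linear_combination p (n + 1) * this
  rw [← momentFunctional_X_mul, e, map_add, map_add, momentFunctional_C_mul,
    momentFunctional_C_mul, O.orth, O.orth, O.orth]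
  simp

theorem IsOrtho.natDegree_X_mul_derivative_le (O : IsOrtho α t p h A B) (m : ℕ) :
    (X * derivative (p m)).natDegree ≤ m := by
  rw [natDegree_le_iff_coeff_eq_zero]
  intro k hk
  rcases k with _ | k
  · simp
  · rw [coeff_X_mul, coeff_derivative, O.coeff_eq_zero hk, zero_mul]

theorem IsOrtho.A_eq (O : IsOrtho α t p h A B) (ht : 0 < t) (n : ℕ) :
    A (n + 1) = 2 * (n + 1 : ℕ) + 1 + α + auxDiag α t p h (n + 1) := by
  have h1 := momentFunctional_derivative (α + 1) ht (p (n + 1) * p (n + 1))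
  have hh := (O.pos (n + 1)).ne'
  rw [O.apply_X_mul_self, ← momentFunctional_X_mul, derivative_mul] at h1
  have e : X * (derivative (p (n + 1)) * p (n + 1) + p (n + 1) * derivative (p (n + 1))) =
      C 2 * (p (n + 1) * (X * derivative (p (n + 1)))) := by
    rw [map_ofNat]; ring
  have e2 : α + 1 - 2 = α - 1 := by ring
  rw [e, e2, momentFunctional_C_mul, O.apply_mul (O.natDegree_X_mul_derivative_le _),
    coeff_X_mul, coeff_derivative, O.coeff_self, add_sub_cancel_right, O.orth,
    if_pos rfl] at h1
  rw [auxDiag]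
  field_simp
  push_cast
  linarith

theorem IsOrtho.B_eq (O : IsOrtho α t p h A B) (n : ℕ) : B (n + 1) = h (n + 1) / h n := by
  have hh := (O.pos n).ne'
  have e : X * (p (n + 1) * p n) = p (n + 2) * p n +
      C (A (n + 1)) * (p (n + 1) * p n) + C (B (n + 1)) * (p n * p n) := by
    have := O.recur (n + 1) (by omega)
    rw [Nat.add_sub_cancel] at this
    linear_combination p n * this
  have e1 : X * (p (n + 1) * p n) = p (n + 1) * (X * p n) := by ring
  have h1 := congrArg (momentFunctional α t) e
  rw [e1, map_add, map_add, momentFunctional_C_mul, momentFunctional_C_mul, O.orth, O.orth, O.orth,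
    O.apply_mul, coeff_X_mul, O.coeff_self, if_neg (by omega), if_neg (by omega), if_pos rfl] at h1
  · field_simp
    linarith
  · rw [natDegree_X_mul (O.monic n).ne_zero, O.natDegree]

theorem IsOrtho.ratio_eq (O : IsOrtho α t p h A B) (ht : 0 < t) (n : ℕ) :
    h (n + 1) / h n = auxOff α t p h n - (p (n + 1)).coeff n := by
  have h1 := momentFunctional_derivative (α + 1) ht (p (n + 1) * p n)
  have hh := (O.pos n).ne'
  have e : X * (derivative (p (n + 1)) * p n + p (n + 1) * derivative (p n)) =
      p n * (X * derivative (p (n + 1)) - C ((n : ℝ) + 1) * p (n + 1))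
        + C ((n : ℝ) + 1) * (p (n + 1) * p n) + p (n + 1) * (X * derivative (p n)) := by ring
  have e1 : X * (p (n + 1) * p n) = p (n + 1) * (X * p n) := by ring
  have e2 : α + 1 - 2 = α - 1 := by ring
  have hdeg : (X * derivative (p (n + 1)) - C ((n : ℝ) + 1) * p (n + 1)).natDegree ≤ n := by
    rw [natDegree_le_iff_coeff_eq_zero]
    intro k hk
    rcases k with _ | k
    · omega
    · rw [coeff_sub, coeff_X_mul, coeff_derivative, coeff_C_mul]
      rcases (Nat.lt_succ_iff.1 hk).eq_or_lt with rfl | hlt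
      · ring
      · rw [O.coeff_eq_zero (by omega)]; ring
  have hco : (X * derivative (p (n + 1)) - C ((n : ℝ) + 1) * p (n + 1)).coeff n =
      -(p (n + 1)).coeff n := by
    rcases n with _ | n
    · simp
    · rw [coeff_sub, coeff_X_mul, coeff_derivative, coeff_C_mul]
      push_cast
      ring
  rw [← momentFunctional_X_mul, ← momentFunctional_X_mul, derivative_mul, e, e1, e2, map_add,
    map_add, O.apply_mul hdeg, hco, momentFunctional_C_mul, O.orth, if_neg (by omega),
    O.apply_mul ((O.natDegree_X_mul_derivative_le n).trans (by omega)), coeff_X_mul,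
    coeff_derivative, O.coeff_eq_zero (Nat.lt_succ_self n), O.apply_mul, coeff_X_mul,
    O.coeff_self, add_sub_cancel_right, O.orth, if_neg (by omega)] at h1
  · rw [auxOff]
    field_simp
    linarith
  · rw [natDegree_X_mul (O.monic n).ne_zero, O.natDegree]

theorem IsOrtho.time_eq (O : IsOrtho α t p h A B) (n : ℕ) :
    t = auxOff α t p h (n + 1) + A (n + 1) * auxDiag α t p h (n + 1) + auxOff α t p h n := by
  have hh := (O.pos n).ne'
  have hh' := (O.pos (n + 1)).ne'
  have e : X * (p (n + 1) * p (n + 1)) = p (n + 2) * p (n + 1) +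
      C (A (n + 1)) * (p (n + 1) * p (n + 1)) + C (B (n + 1)) * (p (n + 1) * p n) := by
    have := O.recur (n + 1) (by omega)
    rw [Nat.add_sub_cancel] at this
    linear_combination p (n + 1) * this
  have h1 := congrArg (momentFunctional (α - 1) t) e
  rw [momentFunctional_X_mul, sub_add_cancel, O.orth, if_pos rfl, map_add, map_add,
    momentFunctional_C_mul, momentFunctional_C_mul, O.B_eq] at h1
  rw [auxOff, auxDiag, auxOff]
  field_simp at h1 ⊢
  linear_combination t * h1

theorem IsOrtho.sub_one_self (O : IsOrtho α t p h A B) (m : ℕ) :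
    momentFunctional (α - 1) t (p m * p m) =
      (p m).coeff 0 * momentFunctional (α - 1) t (p m) := by
  rw [O.apply_mul_sub_one (by rw [O.natDegree]; omega), O.coeff_eq_zero (Nat.lt_succ_self m)]
  ring

theorem IsOrtho.sub_one_off (O : IsOrtho α t p h A B) (n : ℕ) :
    momentFunctional (α - 1) t (p (n + 1) * p n) =
      (p n).coeff 0 * momentFunctional (α - 1) t (p (n + 1)) := by
  rw [O.apply_mul_sub_one (by rw [O.natDegree]; omega),
    O.coeff_eq_zero (m := n) (k := n + 1 + 1) (by omega)]
  ring

theorem IsOrtho.sub_one_off' (O : IsOrtho α t p h A B) (n : ℕ) :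
    momentFunctional (α - 1) t (p (n + 1) * p n) =
      (p (n + 1)).coeff 0 * momentFunctional (α - 1) t (p n) + h n := by
  rw [mul_comm, O.apply_mul_sub_one (by rw [O.natDegree]), O.coeff_self, one_mul]

theorem IsOrtho.ibp_self (O : IsOrtho α t p h A B) (ht : 0 < t) (m : ℕ) :
    α * momentFunctional (α - 1) t (p m * p m) + t * momentFunctional (α - 2) t (p m * p m) =
      h m := by
  have h1 := momentFunctional_derivative α ht (p m * p m)
  have e : derivative (p m) * p m + p m * derivative (p m) = C 2 * (p m * derivative (p m)) := by
    rw [map_ofNat]; ring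
  rw [derivative_mul, e, momentFunctional_C_mul, O.apply_mul, coeff_derivative,
    O.coeff_eq_zero (Nat.lt_succ_self m), O.orth, if_pos rfl] at h1
  · linarith
  · exact (natDegree_derivative_le _).trans (by rw [O.natDegree]; omega)

theorem IsOrtho.ibp_off (O : IsOrtho α t p h A B) (ht : 0 < t) (n : ℕ) :
    α * momentFunctional (α - 1) t (p (n + 1) * p n) +
      t * momentFunctional (α - 2) t (p (n + 1) * p n) = -((n : ℝ) + 1) * h n := by
  have h1 := momentFunctional_derivative α ht (p (n + 1) * p n)
  rw [derivative_mul, map_add, mul_comm (derivative (p (n + 1))), O.apply_mul, coeff_derivative,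
    O.coeff_self, O.apply_mul, coeff_derivative, O.coeff_eq_zero (by omega), O.orth,
    if_neg (by omega)] at h1
  · linarith
  · exact (natDegree_derivative_le _).trans (by rw [O.natDegree]; omega)
  · exact (natDegree_derivative_le _).trans (by rw [O.natDegree]; omega)

theorem IsOrtho.auxOff_sq (O : IsOrtho α t p h A B) (n : ℕ) :
    auxOff α t p h n ^ 2 - t * auxOff α t p h n =
      h (n + 1) / h n * auxDiag α t p h (n + 1) * auxDiag α t p h n := by
  have hK := (O.pos n).ne'
  have hH := (O.pos (n + 1)).ne'
  have h1 := O.sub_one_off n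
  have h2 := O.sub_one_off' n
  rw [auxOff, auxDiag, auxDiag, O.sub_one_self, O.sub_one_self, h1]
  rw [h1] at h2
  set ρ := (p n).coeff 0
  set π := (p (n + 1)).coeff 0
  set c := momentFunctional (α - 1) t (p (n + 1))
  set e := momentFunctional (α - 1) t (p n)
  field_simp
  linear_combination t ^ 2 * ρ * c * h2

theorem IsOrtho.auxOff_linear (O : IsOrtho α t p h A B) (ht : 0 < t) (n : ℕ) :
    t * ((n : ℝ) + 1) - (2 * ((n : ℝ) + 1) + α) * auxOff α t p h n =
      h (n + 1) / h n * (auxDiag α t p h (n + 1) + auxDiag α t p h n) := by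
  have hK := (O.pos n).ne'
  have hH := (O.pos (n + 1)).ne'
  have h1 := O.sub_one_off n
  have h2 := O.sub_one_off' n
  have h3 := O.ibp_self ht (n + 1)
  have h4 := O.ibp_self ht n
  have h5 := O.ibp_off ht n
  have h6 := O.ibp_off ht n
  rw [mul_comm (p (n + 1)) (p n), O.apply_mul_sub_two (by rw [O.natDegree]),
    mul_comm (p n) (p (n + 1))] at h6
  rw [O.apply_mul_sub_two (by rw [O.natDegree]; omega)] at h3 h4 h5
  rw [auxOff, auxDiag, auxDiag]
  rw [h1] at h2 h5 h6 ⊢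
  rw [O.sub_one_self] at h3 h4
  rw [O.sub_one_self, O.sub_one_self]
  set ρ := (p n).coeff 0
  set π := (p (n + 1)).coeff 0
  set c := momentFunctional (α - 1) t (p (n + 1))
  set e := momentFunctional (α - 1) t (p n)
  set ρ₁ := (p n).coeff 1
  set π₁ := (p (n + 1)).coeff 1
  set c₂ := momentFunctional (α - 2) t (p (n + 1))
  set e₂ := momentFunctional (α - 2) t (p n)
  set H := h (n + 1)
  set K := h n
  have key : H * (ρ * e) + K * (π * c) =
      K * (((n : ℝ) + 1) * K - (2 * ((n : ℝ) + 1) + α) * (ρ * c)) := by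
    linear_combination (-ρ * e) * h3 + π * e * h5 + ρ * c * h6 - π * c * h4 +
      (((n : ℝ) + 1) * K - α * (ρ * c)) * h2
  field_simp
  linear_combination -key

theorem IsOrtho.auxDiag_nonneg (O : IsOrtho α t p h A B) (ht : 0 < t) (m : ℕ) :
    0 ≤ auxDiag α t p h m :=
  div_nonneg (mul_nonneg ht.le (momentFunctional_mul_self_nonneg _ ht _)) (O.pos m).le

theorem IsOrtho.mul_auxDiag_le (O : IsOrtho α t p h A B) (ht : 0 < t) (m : ℕ) :
    α * auxDiag α t p h m ≤ t := by
  have h1 := O.ibp_self ht m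
  have h2 := mul_nonneg ht.le (momentFunctional_mul_self_nonneg (α - 2) ht (p m))
  have h3 := O.pos m
  rw [auxDiag, ← mul_div_assoc, div_le_iff₀ h3]
  nlinarith

theorem IsOrtho.le_mul_auxDiag (O : IsOrtho α t p h A B) (hα : 0 < α) (ht : 0 < t) (n : ℕ) :
    t ≤ A (n + 1) * auxDiag α t p h (n + 1) := by
  have ha := O.auxDiag_nonneg ht (n + 1)
  have hA : 0 < A (n + 1) := by rw [O.A_eq ht]; positivity
  have hh := O.pos (n + 1)
  have h1 := momentFunctional_mul_self_nonneg (α - 1) ht ((C (A (n + 1))⁻¹ * X - 1) * p (n + 1))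
  have e : (C (A (n + 1))⁻¹ * X - 1) * p (n + 1) * ((C (A (n + 1))⁻¹ * X - 1) * p (n + 1)) =
      C ((A (n + 1))⁻¹ ^ 2) * (X * (X * (p (n + 1) * p (n + 1)))) -
      C (2 * (A (n + 1))⁻¹) * (X * (p (n + 1) * p (n + 1))) + p (n + 1) * p (n + 1) := by
    simp only [map_mul, map_pow, map_ofNat]
    ring
  rw [e, map_add, map_sub, momentFunctional_C_mul, momentFunctional_C_mul,
    momentFunctional_X_mul, momentFunctional_X_mul, sub_add_cancel, O.apply_X_mul_self,
    momentFunctional_X_mul, sub_add_cancel, O.orth, if_pos rfl] at h1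
  rw [auxDiag]
  have h2 : (A (n + 1))⁻¹ ^ 2 * (A (n + 1) * h (n + 1)) = (A (n + 1))⁻¹ * h (n + 1) := by
    field_simp
  rw [h2] at h1
  have h3 : h (n + 1) ≤ A (n + 1) * momentFunctional (α - 1) t (p (n + 1) * p (n + 1)) := by
    rw [← div_le_iff₀' hA, div_eq_inv_mul]
    linarith
  rw [← mul_div_assoc, le_div_iff₀ hh]
  nlinarith

theorem IsOrtho.auxDiag_pos (O : IsOrtho α t p h A B) (hα : 0 < α) (ht : 0 < t) (n : ℕ) :
    0 < auxDiag α t p h (n + 1) := by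
  have ha := O.auxDiag_nonneg ht (n + 1)
  refine ha.lt_of_ne fun h0 => ?_
  have := O.le_mul_auxDiag hα ht n
  rw [← h0, mul_zero] at this
  exact this.not_gt ht

end ortho

theorem hasDerivAt_mul_of_eq_zero {f c : ℝ → ℝ} {f' x : ℝ} (hf : HasDerivAt f f' x)
    (hc : ContinuousAt c x) (h0 : f x = 0) : HasDerivAt (fun y => f y * c y) (f' * c x) x := by
  rw [hasDerivAt_iff_tendsto_slope] at hf ⊢
  have := hf.mul (hc.tendsto.mono_left nhdsWithin_le_nhds)
  refine this.congr fun y => ?_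
  simp only [slope_def_field, h0]
  ring

section family

open Polynomial

theorem continuousOn_moment (a : ℝ) : ContinuousOn (moment a) (Ioi 0) := fun _ ht =>
  (hasDerivAt_moment a ht).continuousAt.continuousWithinAt

theorem continuousOn_momentFunctional (a : ℝ) {q : ℝ → ℝ[X]} {D : ℕ}
    (hD : ∀ t > 0, (q t).natDegree < D)
    (hq : ∀ i, ContinuousOn (fun t => (q t).coeff i) (Ioi 0)) :
    ContinuousOn (fun t => momentFunctional a t (q t)) (Ioi 0) := by
  have : ContinuousOn (fun t => ∑ i ∈ Finset.range D, moment (a + i) t * (q t).coeff i)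
      (Ioi 0) :=
    continuousOn_finsetSum _ fun i _ => (continuousOn_moment (a + i)).mul (hq i)
  exact this.congr fun t ht => momentFunctional_eq_sum a t (hD t ht)

theorem hasDerivAt_momentFunctional_sub (a : ℝ) {q : ℝ → ℝ[X]} {D : ℕ} {t₀ : ℝ} (ht₀ : 0 < t₀)
    (hD : ∀ t > 0, (q t).natDegree < D)
    (hq : ∀ i, ContinuousOn (fun t => (q t).coeff i) (Ioi 0)) :
    HasDerivAt (fun t => momentFunctional a t (q t) - momentFunctional a t₀ (q t))
      (-momentFunctional (a - 1) t₀ (q t₀)) t₀ := by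
  have hs : HasDerivAt (fun t => ∑ i ∈ Finset.range D,
      (moment (a + i) t - moment (a + i) t₀) * (q t).coeff i)
      (∑ i ∈ Finset.range D, -moment (a + i - 1) t₀ * (q t₀).coeff i) t₀ :=
    HasDerivAt.fun_sum fun i _ => hasDerivAt_mul_of_eq_zero
      ((hasDerivAt_moment (a + i) ht₀).sub_const _)
      ((hq i).continuousAt (Ioi_mem_nhds ht₀)) (sub_self _)
  have he : (fun t => momentFunctional a t (q t) - momentFunctional a t₀ (q t)) =ᶠ[𝓝 t₀]
      fun t => ∑ i ∈ Finset.range D, (moment (a + i) t - moment (a + i) t₀) * (q t).coeff i := by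
    filter_upwards [Ioi_mem_nhds ht₀] with t ht
    rw [momentFunctional_eq_sum a t (hD t ht), momentFunctional_eq_sum a t₀ (hD t ht),
      ← Finset.sum_sub_distrib]
    exact Finset.sum_congr rfl fun i _ => by ring
  refine (hs.congr_of_eventuallyEq he).congr_deriv ?_
  rw [momentFunctional_eq_sum _ _ (hD t₀ ht₀), ← Finset.sum_neg_distrib]
  refine Finset.sum_congr rfl fun i _ => ?_
  have : a - 1 + i = a + i - 1 := by ring
  rw [this, neg_mul]

theorem continuousOn_coeff_mul {q r : ℝ → ℝ[X]} {s : Set ℝ}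
    (hq : ∀ i, ContinuousOn (fun t => (q t).coeff i) s)
    (hr : ∀ i, ContinuousOn (fun t => (r t).coeff i) s) (i : ℕ) :
    ContinuousOn (fun t => (q t * r t).coeff i) s := by
  simp only [coeff_mul]
  exact continuousOn_finsetSum _ fun x _ => (hq x.1).mul (hr x.2)

variable {α : ℝ} {p : ℕ → ℝ → ℝ[X]} {h A B : ℕ → ℝ → ℝ}

theorem natDegree_mul_lt (O : ∀ t > 0, IsOrtho α t (p · t) (h · t) (A · t) (B · t)) {t₁ t₂ : ℝ}
    (ht₁ : 0 < t₁) (ht₂ : 0 < t₂) (m k : ℕ) : (p m t₁ * p k t₂).natDegree < m + k + 1 := by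
  refine Nat.lt_succ_of_le (natDegree_mul_le.trans ?_)
  have h1 := (O t₁ ht₁).natDegree m
  have h2 := (O t₂ ht₂).natDegree k
  rw [h1, h2]

theorem continuousOn_norm (O : ∀ t > 0, IsOrtho α t (p · t) (h · t) (A · t) (B · t)) {m : ℕ}
    (hm : ∀ i, ContinuousOn (fun t => (p m t).coeff i) (Ioi 0)) :
    ContinuousOn (h m) (Ioi 0) := by
  refine (continuousOn_momentFunctional α (fun t ht => natDegree_mul_lt O ht ht m m)
    (continuousOn_coeff_mul hm hm)).congr fun t ht => ?_
  simp only [(O t ht).orth m m, if_true]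

theorem continuousOn_coeff (O : ∀ t > 0, IsOrtho α t (p · t) (h · t) (A · t) (B · t)) (m : ℕ) :
    ∀ i, ContinuousOn (fun t => (p m t).coeff i) (Ioi 0) := by
  have hp0 : ∀ t > 0, p 0 t = 1 := fun t ht =>
    (Monic.natDegree_eq_zero ((O t ht).monic 0)).1 ((O t ht).natDegree 0)
  have key : (∀ i, ContinuousOn (fun t => (p m t).coeff i) (Ioi 0)) ∧
      ∀ i, ContinuousOn (fun t => (p (m + 1) t).coeff i) (Ioi 0) := by
    induction m with
    | zero =>
      refine ⟨fun i => continuousOn_const.congr fun t ht => by rw [hp0 t ht], fun i => ?_⟩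
      rcases i with _ | _ | i
      · have hc : ContinuousOn (fun t => -(moment (α + 1) t / moment α t)) (Ioi 0) := by
          refine ((continuousOn_moment _).div (continuousOn_moment _) fun t ht => ?_).neg
          have h0 := (O t ht).orth 0 0
          have := (O t ht).pos 0
          simp only [hp0 t ht, if_true, mul_one] at h0
          rw [← monomial_zero_one, momentFunctional_monomial] at h0
          simp only [Nat.cast_zero, add_zero, mul_one] at h0
          rw [h0]
          exact this.ne'
        refine hc.congr fun t ht => ?_
        have h0 := (O t ht).orth 0 0
        have h1 := (O t ht).orth 1 0
        have hpos := (O t ht).pos 0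
        simp only [hp0 t ht, if_true, mul_one] at h0 h1
        rw [if_neg (by omega), momentFunctional_eq_sum α t (D := 2)
          (by have := (O t ht).natDegree 1; omega)] at h1
        rw [← monomial_zero_one, momentFunctional_monomial] at h0
        have hc1 := (O t ht).coeff_self 1
        simp only [Finset.sum_range_succ, Finset.sum_range_zero, Nat.cast_zero, add_zero, zero_add,
          Nat.cast_one, hc1, mul_one] at h1 h0
        rw [← h0] at hpos
        change (p 1 t).coeff 0 = _
        field_simp
        linarith
      · exact continuousOn_const.congr fun t ht => (O t ht).coeff_self 1
      · exact continuousOn_const.congr fun t ht =>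
          (O t ht).coeff_eq_zero (m := 1) (by omega)
    | succ m ih =>
      refine ⟨ih.2, fun i => ?_⟩
      have hh := continuousOn_norm O ih.2
      have hA : ContinuousOn (A (m + 1)) (Ioi 0) := by
        refine ((continuousOn_momentFunctional (α + 1)
          (fun t ht => natDegree_mul_lt O ht ht (m + 1) (m + 1))
          (continuousOn_coeff_mul ih.2 ih.2)).div hh
          fun t ht => ((O t ht).pos _).ne').congr fun t ht => ?_
        have hpos := (O t ht).pos (m + 1)
        have := (O t ht).apply_X_mul_self m
        rw [Pi.div_apply, this, mul_div_cancel_right₀ _ hpos.ne']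
      have hB : ContinuousOn (B (m + 1)) (Ioi 0) :=
        (hh.div (continuousOn_norm O ih.1) fun t ht => ((O t ht).pos _).ne').congr
          fun t ht => (O t ht).B_eq m
      have hX : ContinuousOn (fun t => (X * p (m + 1) t).coeff i) (Ioi 0) := by
        rcases i with _ | i
        · simpa using continuousOn_const
        · simpa only [coeff_X_mul] using ih.2 i
      refine ((hX.sub (hA.mul (ih.2 i))).sub (hB.mul (ih.1 i))).congr fun t ht => ?_
      have := congrArg (fun q => q.coeff i) ((O t ht).recur (m + 1) (by omega))
      simp only [coeff_add, coeff_C_mul, Nat.add_sub_cancel] at this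
      simp only [Pi.sub_apply, Pi.mul_apply]
      linarith
  exact key.1

theorem continuousOn_coeff_mul_const
    (O : ∀ t > 0, IsOrtho α t (p · t) (h · t) (A · t) (B · t)) (m : ℕ) (r : ℝ[X]) (i : ℕ) :
    ContinuousOn (fun t => (p m t * r).coeff i) (Ioi 0) :=
  continuousOn_coeff_mul (continuousOn_coeff O m) (fun _ => continuousOn_const) i

theorem hasDerivAt_norm (O : ∀ t > 0, IsOrtho α t (p · t) (h · t) (A · t) (B · t)) (m : ℕ)
    {t : ℝ} (ht : 0 < t) :
    HasDerivAt (h m) (-(h m t * auxDiag α t (p · t) (h · t) m / t)) t := by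
  have hd := (hasDerivAt_momentFunctional_sub α ht (q := fun s => p m s * p m t)
    (fun s hs => natDegree_mul_lt O hs ht m m)
    (continuousOn_coeff_mul_const O m (p m t))).add_const (h m t)
  have hpos := (O t ht).pos m
  refine (hd.congr_of_eventuallyEq ?_).congr_deriv ?_
  · filter_upwards [Ioi_mem_nhds ht] with s hs
    have h1 := (O s hs).apply_mul (m := m) (q := p m t) ((O t ht).natDegree m).le
    have h2 := (O t ht).apply_mul (m := m) (q := p m s) ((O s hs).natDegree m).le
    have h3 := (O t ht).coeff_self m
    have h4 := (O s hs).coeff_self m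
    rw [mul_comm] at h2
    rw [h1, h2, h3, h4]
    ring
  · rw [auxDiag]
    field_simp

theorem hasDerivAt_coeff (O : ∀ t > 0, IsOrtho α t (p · t) (h · t) (A · t) (B · t)) (n : ℕ)
    {t : ℝ} (ht : 0 < t) :
    HasDerivAt (fun s => (p (n + 1) s).coeff n) (auxOff α t (p · t) (h · t) n / t) t := by
  have hd := ((hasDerivAt_momentFunctional_sub α ht (q := fun s => p (n + 1) s * p n t)
    (fun s hs => natDegree_mul_lt O hs ht (n + 1) n)
    (continuousOn_coeff_mul_const O (n + 1) (p n t))).neg.div_const (h n t)).add_const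
      ((p (n + 1) t).coeff n)
  have hpos := (O t ht).pos n
  refine (hd.congr_of_eventuallyEq ?_).congr_deriv ?_
  · filter_upwards [Ioi_mem_nhds ht] with s hs
    have h1 := (O s hs).apply_mul (m := n + 1) (q := p n t)
      (((O t ht).natDegree n).le.trans (by omega))
    have h2 := (O t ht).apply_mul (m := n) (q := p (n + 1) s - p (n + 1) t) (by
      rw [natDegree_le_iff_coeff_eq_zero]
      intro k hk
      rw [coeff_sub]
      rcases (Nat.succ_le_of_lt hk).eq_or_lt with rfl | hlt
      · have h3 := (O t ht).coeff_self (n + 1)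
        have h4 := (O s hs).coeff_self (n + 1)
        rw [Nat.succ_eq_add_one, h3, h4, sub_self]
      · have h3 := (O t ht).coeff_eq_zero hlt
        have h4 := (O s hs).coeff_eq_zero hlt
        rw [h3, h4, sub_self])
    have h5 := (O t ht).orth n (n + 1)
    have h6 := (O t ht).coeff_eq_zero (m := n) (Nat.lt_succ_self n)
    rw [mul_sub, map_sub, h5, if_neg (by omega), coeff_sub, mul_comm (p n t)] at h2
    simp only [Pi.neg_apply]
    rw [h1, h6]
    field_simp
    linarith
  · rw [auxOff]
    field_simp

theorem hasDerivAt_auxDiag (O : ∀ t > 0, IsOrtho α t (p · t) (h · t) (A · t) (B · t)) (n : ℕ)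
    {t a b : ℝ} (ht : 0 < t) (ha : auxDiag α t (p · t) (h · t) (n + 1) = a)
    (hb : auxOff α t (p · t) (h · t) n = b) :
    HasDerivAt (fun t => auxDiag α t (p · t) (h · t) (n + 1))
      ((2 * b + (2 * (n + 1) + 1 + α + a) * a - t) / t) t := by
  have hd := ((hasDerivAt_coeff O n ht).sub (hasDerivAt_coeff O (n + 1) ht)).sub_const
    (2 * ((n : ℝ) + 1) + 1 + α)
  refine (hd.congr_of_eventuallyEq ?_).congr_deriv ?_
  · filter_upwards [Ioi_mem_nhds ht] with s hs
    have h1 := (O s hs).A_eq hs n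
    have h2 := (O s hs).A_eq_coeff n
    push_cast at h1
    simp only [Pi.sub_apply]
    linarith
  · have h1 := (O t ht).A_eq ht n
    have h2 := (O t ht).time_eq n
    push_cast at h1
    rw [h1] at h2
    subst ha hb
    rw [← sub_div]
    congr 1
    linarith

theorem hasDerivAt_auxOff (O : ∀ t > 0, IsOrtho α t (p · t) (h · t) (A · t) (B · t)) (n : ℕ)
    {t a b : ℝ} (hα : 0 < α) (ht : 0 < t) (ha : auxDiag α t (p · t) (h · t) (n + 1) = a)
    (hb : auxOff α t (p · t) (h · t) n = b) :
    HasDerivAt (fun t => auxOff α t (p · t) (h · t) n)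
      ((b + 2 * (b ^ 2 - t * b) / a - t * (n + 1) + (2 * (n + 1) + α) * b) / t) t := by
  have hh := ((O t ht).pos n).ne'
  have hd := ((hasDerivAt_norm O (n + 1) ht).div (hasDerivAt_norm O n ht) hh).add
    (hasDerivAt_coeff O n ht)
  refine (hd.congr_of_eventuallyEq ?_).congr_deriv ?_
  · filter_upwards [Ioi_mem_nhds ht] with s hs
    have h1 := (O s hs).ratio_eq hs n
    simp only [Pi.add_apply, Pi.div_apply]
    linarith
  · have h1 := (O t ht).auxOff_sq n
    have h2 := (O t ht).auxOff_linear ht n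
    have h3 : a ≠ 0 := ha ▸ ((O t ht).auxDiag_pos hα ht n).ne'
    rw [ha, hb] at h1 h2
    rw [ha, hb]
    set c := auxDiag α t (p · t) (h · t) n
    rw [div_mul_eq_mul_div, div_mul_eq_mul_div, eq_div_iff hh] at h1
    rw [div_mul_eq_mul_div, eq_div_iff hh] at h2
    field_simp
    linear_combination (-2) * h1 + a * h2

theorem B_eq_of_aux (O : ∀ t > 0, IsOrtho α t (p · t) (h · t) (A · t) (B · t)) (n : ℕ)
    {t a b : ℝ} (hα : 0 < α) (ht : 0 < t) (ha : auxDiag α t (p · t) (h · t) (n + 1) = a)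
    (hb : auxOff α t (p · t) (h · t) n = b) :
    B (n + 1) t =
      ((t * (n + 1) - (2 * (n + 1) + α) * b) * a - (b ^ 2 - t * b)) / a ^ 2 := by
  have h1 := (O t ht).auxOff_sq n
  have h2 := (O t ht).auxOff_linear ht n
  have h3 : a ≠ 0 := ha ▸ ((O t ht).auxDiag_pos hα ht n).ne'
  rw [ha, hb, ← (O t ht).B_eq] at h1 h2
  rw [eq_div_iff (pow_ne_zero 2 h3)]
  linear_combination h1 - a * h2

theorem exists_isSol (hα : 0 < α)
    (O : ∀ t > 0, IsOrtho α t (p · t) (h · t) (A · t) (B · t)) (n : ℕ) (hn : 1 ≤ n) :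
    ∃ u z : ℝ → ℝ, IsSol α (kap α n) (eps n) u z ∧
      ∀ t > 0, B n t = (n : ℝ) ^ 2 + α * n +
        ((Real.exp (u (Real.log (2 * n * t))) - α) ^ 2 -
          (z (Real.log (2 * n * t)) + t / Real.exp (u (Real.log (2 * n * t)))) ^ 2) / 4 := by
  obtain ⟨n, rfl⟩ : ∃ k, n = k + 1 := ⟨n - 1, by omega⟩
  have hN : (0 : ℝ) < n + 1 := by positivity
  set g : ℝ → ℝ := fun τ => Real.exp τ / (2 * (n + 1)) with hg
  have hg0 : ∀ τ, 0 < g τ := fun τ => by positivity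
  have hgd : ∀ τ, HasDerivAt g (g τ) τ := fun τ => (Real.hasDerivAt_exp τ).div_const _
  set a : ℝ → ℝ := fun τ => auxDiag α (g τ) (p · (g τ)) (h · (g τ)) (n + 1) with ha
  set b : ℝ → ℝ := fun τ => auxOff α (g τ) (p · (g τ)) (h · (g τ)) n with hb
  have ha0 : ∀ τ, 0 < a τ := fun τ => (O _ (hg0 τ)).auxDiag_pos hα (hg0 τ) n
  have had : ∀ τ, HasDerivAt a (2 * b τ + (2 * (n + 1) + 1 + α + a τ) * a τ - g τ) τ := fun τ =>
    ((hasDerivAt_auxDiag O n (hg0 τ) rfl rfl).comp τ (hgd τ)).congr_deriv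
      (div_mul_cancel₀ _ (hg0 τ).ne')
  have hbd : ∀ τ, HasDerivAt b (b τ + 2 * (b τ ^ 2 - g τ * b τ) / a τ - g τ * (n + 1) +
      (2 * (n + 1) + α) * b τ) τ := fun τ =>
    ((hasDerivAt_auxOff O n hα (hg0 τ) rfl rfl).comp τ (hgd τ)).congr_deriv
      (div_mul_cancel₀ _ (hg0 τ).ne')
  have hxα : ∀ τ, α ≤ g τ / a τ := fun τ => by
    rw [le_div_iff₀ (ha0 τ)]
    exact (O _ (hg0 τ)).mul_auxDiag_le (hg0 τ) (n + 1)
  have hx0 : ∀ τ, 0 < g τ / a τ := fun τ => hα.trans_le (hxα τ)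
  have hexp : ∀ τ, Real.exp (Real.log (g τ / a τ)) = g τ / a τ := fun τ => Real.exp_log (hx0 τ)
  have hes : ∀ τ, Real.exp τ = 2 * (n + 1) * g τ := fun τ => by
    simp only [hg]; field_simp
  refine ⟨fun τ => Real.log (g τ / a τ),
    fun τ => 1 - (2 * b τ / a τ + (2 * (n + 1) + 1 + α) + a τ - g τ / a τ),
    ⟨fun τ => ?_, fun τ => ?_, fun τ => Real.log_le_log hα (hxα τ), ?_⟩, fun t ht => ?_⟩
  · refine (((hgd τ).div (had τ) (ha0 τ).ne').log (hx0 τ).ne').congr_deriv ?_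
    have := (ha0 τ).ne'
    have := (hg0 τ).ne'
    simp only [Pi.div_apply]
    field_simp
    ring
  · have h0 := (ha0 τ).ne'
    have h1 := (hg0 τ).ne'
    refine ((((((((hbd τ).const_mul 2).div (had τ) h0)).add_const
      (2 * ((n : ℝ) + 1) + 1 + α)).add (had τ)).sub
        ((hgd τ).div (had τ) h0)).const_sub 1).congr_deriv ?_
    have e1 : Real.exp (τ - Real.log (g τ / a τ)) = 2 * (n + 1) * a τ := by
      rw [Real.exp_sub, hexp, hes]; field_simp
    rw [forcing, exp_two_mul, exp_two_mul, e1, hexp, kap, eps]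
    push_cast
    field_simp
    ring
  · refine ⟨Real.log (2 * (n + 1) + 1 + α + 1 / α), fun τ => ?_⟩
    have h1 := (O _ (hg0 τ)).le_mul_auxDiag hα (hg0 τ) n
    rw [(O _ (hg0 τ)).A_eq (hg0 τ)] at h1
    push_cast at h1
    have h2 : g τ / a τ ≤ 2 * (n + 1) + 1 + α + a τ := by rwa [div_le_iff₀ (ha0 τ)]
    have h3 : a τ ≤ g τ / α := by
      rw [le_div_iff₀ hα, mul_comm]
      exact (O _ (hg0 τ)).mul_auxDiag_le (hg0 τ) (n + 1)
    have h4 : g τ ≤ Real.exp (max τ 0) := by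
      refine (div_le_self (Real.exp_pos _).le (by linarith [(n.cast_nonneg : (0 : ℝ) ≤ n)])).trans
        (Real.exp_le_exp.2 (le_max_left _ _))
    have h5 : 1 ≤ Real.exp (max τ 0) := Real.one_le_exp (le_max_right _ _)
    rw [Real.log_le_iff_le_exp (hx0 τ), Real.exp_add, Real.exp_log (by positivity)]
    have h6 : g τ / α ≤ 1 / α * Real.exp (max τ 0) := by
      rw [div_mul_eq_mul_div, one_mul]; gcongr
    nlinarith
  · have hgt : g (Real.log (2 * (n + 1) * t)) = t := by
      simp only [hg]
      rw [Real.exp_log (by positivity)]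
      field_simp
    push_cast
    set τ := Real.log (2 * (n + 1) * t)
    have h1 := B_eq_of_aux O n hα (hg0 τ) rfl rfl
    have h0 := (ha0 τ).ne'
    rw [← hgt, h1, hexp]
    change ((g τ * (n + 1) - (2 * (n + 1) + α) * b τ) * a τ - (b τ ^ 2 - g τ * b τ)) / a τ ^ 2 = _
    have h2 := (hg0 τ).ne'
    rw [hgt]
    rw [hgt] at h2
    field_simp
    ring

end family

theorem exists_isOrtho {α : ℝ} {P : ℕ → ℝ → ℝ → ℝ} {h A B : ℕ → ℝ → ℝ}
    (hmonic : ∀ m : ℕ, ∀ τ > (0:ℝ), ∃ p : Polynomial ℝ,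
      p.Monic ∧ p.natDegree = m ∧ ∀ x, P m τ x = p.eval x)
    (horth : ∀ j k : ℕ, ∀ τ > (0:ℝ),
      (∫ x in Ioi (0:ℝ), P j τ x * P k τ x * pertLagWeight α τ x)
        = if j = k then h j τ else 0)
    (hpos : ∀ j : ℕ, ∀ τ > (0:ℝ), 0 < h j τ)
    (hrec : ∀ m : ℕ, 1 ≤ m → ∀ τ > (0:ℝ), ∀ x : ℝ,
      x * P m τ x = P (m + 1) τ x + A m τ * P m τ x + B m τ * P (m - 1) τ x) :
    ∃ p : ℕ → ℝ → Polynomial ℝ, ∀ t > 0, IsOrtho α t (p · t) (h · t) (A · t) (B · t) := by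
  choose! p hp using hmonic
  refine ⟨p, fun t ht => ⟨fun m => (hp m t ht).1, fun m => (hp m t ht).2.1, fun j k => ?_,
    fun m => hpos m t ht, fun m hm => ?_⟩⟩
  · rw [← horth j k t ht, ← (integrableOn_eval_mul α ht _).2]
    simp only [Polynomial.eval_mul, (hp j t ht).2.2, (hp k t ht).2.2]
  · refine Polynomial.funext fun x => ?_
    have := hrec m hm t ht x
    rw [(hp m t ht).2.2, (hp (m + 1) t ht).2.2, (hp (m - 1) t ht).2.2] at this
    simpa using this

theorem mul_exp_sub_one_le {φ e : ℝ} (he : 0 ≤ e) :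
    (1 + e) * (Real.exp φ - 1) ≤ Real.exp (φ + e * φ) - 1 := by
  have h1 := exp_sub_exp_le φ 0
  have h2 := Real.add_one_le_exp (e * φ)
  rw [Real.exp_zero, sub_zero] at h1
  have h3 := mul_le_mul_of_nonneg_left h1 he
  have h4 := mul_le_mul_of_nonneg_left h2 (Real.exp_pos φ).le
  rw [Real.exp_add]
  nlinarith

/-- Amplification factor of the upper barrier for the finite `n` solutions. -/
noncomputable def barrier (α : ℝ) (n : ℕ) (τ : ℝ) : ℝ :=
  (1 + α + 1 / (2 * α)) * (n + Real.exp τ) / (n : ℝ) ^ 2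

section comparison

variable {α : ℝ} {V Z u z : ℝ → ℝ} {n : ℕ}

theorem IsSol.exp_mul_le (hV : IsSol α 1 0 V Z) (hα : 0 < α)
    (hn : 4 * max α 1 ^ 2 / α + 64 / α ^ 3 ≤ n) (τ : ℝ) :
    Real.exp (V τ) * (V τ - Real.log α + 2 * Z τ) ≤ (n + Real.exp τ) / 2 := by
  set M := max α 1 with hM
  have h1 := hV.exp_le_add hα (le_max_left α 1) (le_max_right α 1) τ
  have h2 := hV.deriv_le_half hα τ
  have h3 := Real.add_one_le_exp (V τ - Real.log α)
  have hx0 := Real.exp_pos (V τ)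
  rw [Real.exp_sub, Real.exp_log hα] at h3
  set y := Real.exp (τ / 3) with hy
  have hy0 : 0 < y := Real.exp_pos _
  have hs : Real.exp τ = y ^ 3 := by
    rw [hy, ← Real.exp_nat_mul]; congr 1; push_cast; ring
  have hM0 : 1 ≤ M := le_max_right _ _
  have h4 : Real.exp (V τ) * (V τ - Real.log α + 2 * Z τ) ≤ Real.exp (V τ) ^ 2 / α := by
    rw [pow_two, mul_div_assoc]
    gcongr
    linarith
  have h5 : Real.exp (V τ) ^ 2 / α ≤ (2 * M ^ 2 + 2 * y ^ 2) / α := by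
    gcongr
    have : Real.exp (V τ) ^ 2 ≤ (M + y) ^ 2 := by gcongr
    nlinarith [sq_nonneg (M - y)]
  have h6 : 2 * y ^ 2 / α ≤ y ^ 3 / 2 + 32 / α ^ 3 := by
    rcases le_total (4 / α) y with h | h
    · have : 4 ≤ y * α := by rwa [div_le_iff₀ hα] at h
      have h7 : 2 * y ^ 2 / α ≤ y ^ 3 / 2 := by
        rw [div_le_iff₀ hα]
        nlinarith [sq_nonneg y]
      have : 0 ≤ 32 / α ^ 3 := by positivity
      linarith
    · have h7 : 2 * y ^ 2 / α ≤ 2 * (4 / α) ^ 2 / α := by gcongr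
      have h8 : 2 * (4 / α) ^ 2 / α = 32 / α ^ 3 := by field_simp; norm_num
      have : 0 ≤ y ^ 3 / 2 := by positivity
      linarith
  rw [add_div] at h5
  have e1 : 4 * M ^ 2 / α = 2 * (2 * M ^ 2 / α) := by ring
  have e2 : 64 / α ^ 3 = 2 * (32 / α ^ 3) := by ring
  rw [hs]
  linarith

theorem IsSol.le_barrier (hV : IsSol α 1 0 V Z) (hu : IsSol α (kap α n) (eps n) u z) (hα : 0 < α)
    (hn1 : 1 ≤ n) (hn : 4 * max α 1 ^ 2 / α + 64 / α ^ 3 ≤ n) (τ : ℝ) :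
    u τ ≤ V τ + barrier α n τ * (V τ - Real.log α) := by
  have hn0 : (0 : ℝ) < n := by exact_mod_cast hn1
  set K := 1 + α + 1 / (2 * α) with hK
  have hK0 : 0 < K := by positivity
  set e₁ : ℝ → ℝ := fun τ => K * Real.exp τ / (n : ℝ) ^ 2 with he₁
  have hed : ∀ x, HasDerivAt (barrier α n) (e₁ x) x := fun x =>
    (((Real.hasDerivAt_exp x).const_add (n : ℝ)).const_mul K).div_const _
  have hed₁ : ∀ x, HasDerivAt e₁ (e₁ x) x := fun x =>
    ((Real.hasDerivAt_exp x).const_mul K).div_const _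
  have hVd : ∀ x, HasDerivAt (fun x => V x - Real.log α) (Z x) x := fun x =>
    (hV.hasDerivAt x).sub_const _
  have he0 : ∀ x, 0 ≤ barrier α n x := fun x => by unfold barrier; positivity
  have hφ0 : ∀ x, 0 ≤ V x - Real.log α := fun x => sub_nonneg.2 (hV.lower x)
  refine hu.le_of_super (v₂ := fun x => V x + barrier α n x * (V x - Real.log α))
    (z₂ := fun x => Z x + (e₁ x * (V x - Real.log α) + barrier α n x * Z x))
    (c₂ := fun x => forcing α 1 0 x (V x) + (e₁ x * (V x - Real.log α) + e₁ x * Z x +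
      (e₁ x * Z x + barrier α n x * forcing α 1 0 x (V x)))) hα
    (by unfold kap; positivity) (by unfold eps; positivity)
    (fun x => (hV.hasDerivAt x).add ((hed x).mul (hVd x)))
    (fun x => (hV.hasDerivAt_deriv x).add (((hed₁ x).mul (hVd x)).add
      ((hed x).mul (hV.hasDerivAt_deriv x)))) (fun x => ?_) (fun x => ?_) τ
  · have h1 := hV.exp_mul_le hα hn x
    have h2 := mul_exp_sub_one_le (φ := V x - Real.log α) (he0 x)
    set e := barrier α n x with he
    set φ := V x - Real.log α with hφ
    have hX : Real.exp (V x) = α * Real.exp φ := by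
      rw [hφ, Real.exp_sub, Real.exp_log hα]; field_simp
    have hXb : Real.exp (V x + e * φ) = α * Real.exp (φ + e * φ) := by
      rw [Real.exp_add, hX, Real.exp_add]; ring
    have h3 : Real.exp φ ≤ Real.exp (φ + e * φ) :=
      Real.exp_le_exp.2 (by nlinarith [he0 x, hφ0 x])
    have hone : 1 ≤ Real.exp φ := Real.one_le_exp (hφ0 x)
    have h4 : (1 + e) * (Real.exp (V x) ^ 2 - α * Real.exp (V x)) ≤
        Real.exp (V x + e * φ) ^ 2 - α * Real.exp (V x + e * φ) := by
      rw [hX, hXb]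
      have : Real.exp φ * ((1 + e) * (Real.exp φ - 1)) ≤
          Real.exp (φ + e * φ) * (Real.exp (φ + e * φ) - 1) := by
        apply mul_le_mul h3 h2 _ (Real.exp_pos _).le
        have := he0 x
        exact mul_nonneg (by positivity) (by linarith)
      have := mul_le_mul_of_nonneg_left this (sq_nonneg α)
      linarith
    have hx0 := Real.exp_pos (V x)
    have hxle : Real.exp (V x) ≤ Real.exp (V x + e * φ) := by
      rw [hX, hXb]; gcongr
    have hα' := hV.le_exp hα x
    have hs0 := Real.exp_pos x
    rw [forcing_one_zero]
    simp only [forcing, exp_two_mul, Real.exp_sub]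
    set X := Real.exp (V x)
    set X' := Real.exp (V x + e * φ)
    set s := Real.exp x
    have hk0 : 0 ≤ kap α n := by unfold kap; positivity
    have h5 : kap α n * (s / X') ≤ kap α n * (s / X) := by gcongr
    have h6 : eps n * (s / X') ^ 2 ≤ eps n * (s / X * (s / α)) := by
      have : 0 ≤ eps n := by unfold eps; positivity
      gcongr
      rw [pow_two]
      gcongr
      exact hα'.trans hxle
    have h7 : e₁ x * (φ + 2 * Z x) ≤ e₁ x * ((n + s) / 2 / X) := by
      have : 0 ≤ e₁ x := by simp only [he₁]; positivity
      gcongr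
      rw [le_div_iff₀ hx0]
      linarith
    have h8 : e₁ x * ((n + s) / 2 / X) = s / X * (K * (n + s) / 2 / n ^ 2) := by
      simp only [he₁]; ring
    have h9 : K * (n + s) / 2 / n ^ 2 + (kap α n - 1) + eps n * (s / α) ≤ e := by
      rw [he, barrier, kap, eps, ← hK, ← sub_nonneg]
      have : K * (n + s) / n ^ 2 - (K * (n + s) / 2 / n ^ 2 + (1 + (1 + α) / (2 * n) - 1)
          + 1 / (4 * n ^ 2) * (s / α)) = (n / (4 * α) + (1 + α) * s / 2) / n ^ 2 := by
        rw [hK]; field_simp; ring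
      change 0 ≤ K * (n + s) / n ^ 2 - _
      rw [this]
      positivity
    have h10 := mul_le_mul_of_nonneg_left h9 (show 0 ≤ s / X by positivity)
    linarith
  · have := mul_nonneg (he0 x) (hφ0 x)
    have := hV.lower x
    linarith

end comparison

/-- The difference between the upper boundary value `e^v - α - δ e^{τ - v}` and the derivative
`z` of `v`. -/
noncomputable def defect (α δ : ℝ) (v z : ℝ → ℝ) (τ : ℝ) : ℝ :=
  Real.exp (v τ) - α - z τ - δ * Real.exp (τ - v τ)

section defect

variable {α δ κ ε : ℝ} {v z V Z u : ℝ → ℝ}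

theorem IsSol.exists_abs_deriv_le (h : IsSol α κ ε v z) (hα : 0 < α) (hκ : 0 ≤ κ) (hε : 0 ≤ ε) :
    ∃ K, ∀ τ ≤ 0, |z τ| ≤ K := by
  obtain ⟨A, hA⟩ := h.growth
  refine ⟨2 * (|Real.log α| + |A + 1|) + (Real.exp (2 * (A + 1)) + α * Real.exp (A + 1)
    + κ * (Real.exp 1 / α) + ε * (Real.exp 1 / α) ^ 2), fun τ hτ =>
    abs_deriv_le h.hasDerivAt h.hasDerivAt_deriv (fun x hx => ?_) (fun x hx => ?_)⟩
  all_goals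
    have hx1 : x ≤ 1 := by linarith [hx.2]
    have hv : v x ≤ A + 1 := (hA x).trans (by gcongr; exact max_le hx1 zero_le_one)
    have hl := h.lower x
  · rw [abs_le]
    constructor <;> linarith [neg_abs_le (Real.log α), le_abs_self (A + 1),
      abs_nonneg (Real.log α), abs_nonneg (A + 1)]
  · have e1 : Real.exp (x - v x) ≤ Real.exp 1 / α :=
      (exp_sub_le_div x hα hl).trans (by gcongr)
    have e2 : Real.exp (2 * v x) ≤ Real.exp (2 * (A + 1)) := by gcongr
    have e3 : α * Real.exp (v x) ≤ α * Real.exp (A + 1) := by gcongr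
    have e4 : κ * Real.exp (x - v x) ≤ κ * (Real.exp 1 / α) := by gcongr
    have e5 : ε * Real.exp (2 * (x - v x)) ≤ ε * (Real.exp 1 / α) ^ 2 := by
      rw [exp_two_mul]; gcongr
    have p2 := Real.exp_pos (2 * v x)
    have p3 : 0 ≤ α * Real.exp (v x) := by positivity
    have p4 : 0 ≤ κ * Real.exp (x - v x) := by positivity
    have p5 : 0 ≤ ε * Real.exp (2 * (x - v x)) := by positivity
    rw [forcing, abs_le]
    constructor <;> linarith

theorem IsSol.hasDerivAt_defect (h : IsSol α (1 + (1 + α) * δ) (δ ^ 2) v z) (τ : ℝ) :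
    HasDerivAt (defect α δ v z) (-(Real.exp (v τ) + δ * Real.exp (τ - v τ)) * defect α δ v z τ
      + Real.exp (τ - v τ)) τ := by
  have h1 := (((h.hasDerivAt τ).exp.sub_const α).sub (h.hasDerivAt_deriv τ)).sub
    ((((hasDerivAt_id τ).sub (h.hasDerivAt τ)).exp).const_mul δ)
  refine h1.congr_deriv ?_
  simp only [forcing, defect, exp_two_mul, Pi.sub_apply, id_eq]
  ring

theorem IsSol.exists_abs_defect_le (h : IsSol α (1 + (1 + α) * δ) (δ ^ 2) v z) (hα : 0 < α)
    (hδ : 0 ≤ δ) : ∃ K, ∀ τ ≤ 0, |defect α δ v z τ| ≤ K := by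
  obtain ⟨A, hA⟩ := h.growth
  obtain ⟨K, hK⟩ := h.exists_abs_deriv_le hα (by positivity) (by positivity)
  refine ⟨Real.exp A + α + K + δ * (1 / α), fun τ hτ => ?_⟩
  have hz := abs_le.1 (hK τ hτ)
  have hv : v τ ≤ A := by simpa [max_eq_right hτ] using hA τ
  have e1 : Real.exp (v τ) ≤ Real.exp A := by gcongr
  have e2 : δ * Real.exp (τ - v τ) ≤ δ * (1 / α) := by
    gcongr
    refine (exp_sub_le_div τ hα (h.lower τ)).trans ?_
    gcongr
    exact Real.exp_le_one_iff.2 hτ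
  have p1 := Real.exp_pos (v τ)
  have p2 : 0 ≤ δ * Real.exp (τ - v τ) := by positivity
  rw [defect, abs_le]
  constructor <;> linarith

theorem defect_zero (V Z : ℝ → ℝ) (τ : ℝ) :
    defect α 0 V Z τ = Real.exp (V τ) - α - Z τ := by
  simp [defect]

theorem IsSol.defect_le (hV : IsSol α 1 0 V Z) (hu : IsSol α (1 + (1 + α) * δ) (δ ^ 2) u z)
    (hα : 0 < α) (hδ : 0 ≤ δ) (τ : ℝ) : defect α δ u z τ ≤ defect α 0 V Z τ := by
  have hV' : IsSol α (1 + (1 + α) * 0) (0 ^ 2) V Z := by simpa using hV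
  obtain ⟨K₁, hK₁⟩ := hu.exists_abs_defect_le hα hδ
  obtain ⟨K₂, hK₂⟩ := hV'.exists_abs_defect_le hα le_rfl
  have hle : ∀ τ, V τ ≤ u τ := hu.mono hV hα zero_le_one le_rfl
    (by linarith [show 0 ≤ (1 + α) * δ by positivity]) (by positivity)
  have hc := hu.continuous
  have := nonneg_of_deriv_ge (D := fun τ => defect α 0 V Z τ - defect α δ u z τ)
    (c := fun τ => Real.exp (u τ) + δ * Real.exp (τ - u τ)) (c₀ := α) (K := K₁ + K₂) (T := τ)
    hα (by fun_prop) (fun x => ?_) (fun x => (hV'.hasDerivAt_defect x).sub (hu.hasDerivAt_defect x))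
    (fun x _ => ?_) (fun x hx => ?_) le_rfl
  · linarith
  · have := hu.le_exp hα x
    have : 0 ≤ δ * Real.exp (x - u x) := by positivity
    linarith
  · have h1 : 0 ≤ defect α 0 V Z x := by
      rw [defect_zero]
      linarith [hV.deriv_le_exp_sub hα x]
    have h2 : Real.exp (x - u x) ≤ Real.exp (x - V x) := by gcongr; exact hle x
    have h3 : Real.exp (V x) ≤ Real.exp (u x) := by gcongr; exact hle x
    have h4 : 0 ≤ δ * Real.exp (x - u x) := by positivity
    have h5 := mul_nonneg (show 0 ≤ Real.exp (u x) + δ * Real.exp (x - u x) - Real.exp (V x) by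
      linarith) h1
    nlinarith
  · linarith [(abs_le.1 (hK₁ x hx)).2, (abs_le.1 (hK₂ x hx)).1]

theorem IsSol.le_defect (hV : IsSol α 1 0 V Z) (hu : IsSol α (1 + (1 + α) * δ) (δ ^ 2) u z)
    (hα : 0 < α) (hδ : 0 ≤ δ) {η T : ℝ} (hη : 0 ≤ η) (hη1 : η ≤ 1)
    (h : ∀ τ ≤ T, (1 - η) * (Real.exp (u τ) ^ 2 + δ * Real.exp τ) ≤ Real.exp (V τ) ^ 2) :
    (1 - η) * defect α 0 V Z T ≤ defect α δ u z T := by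
  have hV' : IsSol α (1 + (1 + α) * 0) (0 ^ 2) V Z := by simpa using hV
  obtain ⟨K₁, hK₁⟩ := hu.exists_abs_defect_le hα hδ
  obtain ⟨K₂, hK₂⟩ := hV'.exists_abs_defect_le hα le_rfl
  have hle : ∀ τ, V τ ≤ u τ := hu.mono hV hα zero_le_one le_rfl
    (by linarith [show 0 ≤ (1 + α) * δ by positivity]) (by positivity)
  have hc := hu.continuous
  have := nonneg_of_deriv_ge (D := fun τ => defect α δ u z τ - (1 - η) * defect α 0 V Z τ)
    (c := fun τ => Real.exp (u τ) + δ * Real.exp (τ - u τ)) (c₀ := α) (K := K₁ + K₂) (T := T)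
    hα (by fun_prop) (fun x => ?_)
    (fun x => (hu.hasDerivAt_defect x).sub ((hV'.hasDerivAt_defect x).const_mul (1 - η)))
    (fun x hx => ?_) (fun x hx => ?_) le_rfl
  · linarith
  · have := hu.le_exp hα x
    have : 0 ≤ δ * Real.exp (x - u x) := by positivity
    linarith
  · have h1 : defect α 0 V Z x ≤ Real.exp x / Real.exp (V x) ^ 2 := by
      rw [defect_zero]
      exact hV.exp_sub_sub_le hα x
    have h3 : Real.exp (V x) ≤ Real.exp (u x) := by gcongr; exact hle x
    have h4 : 0 ≤ δ * Real.exp (x - u x) := by positivity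
    have h5 := mul_le_mul_of_nonneg_left h1 (show 0 ≤ (1 - η) *
      (Real.exp (u x) + δ * Real.exp (x - u x) - Real.exp (V x)) from
        mul_nonneg (by linarith) (by linarith))
    have h6 := h x hx
    have h7 : (1 - η) * (Real.exp (u x) + δ * Real.exp (x - u x) - Real.exp (V x)) *
        (Real.exp x / Real.exp (V x) ^ 2) + (1 - η) * Real.exp (x - V x) ≤ Real.exp (x - u x) := by
      rw [Real.exp_sub, Real.exp_sub]
      have hX := Real.exp_pos (u x)
      have hx0 := Real.exp_pos (V x)
      have hs := Real.exp_pos x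
      have e : (1 - η) * (Real.exp (u x) + δ * (Real.exp x / Real.exp (u x)) - Real.exp (V x)) *
        (Real.exp x / Real.exp (V x) ^ 2) + (1 - η) * (Real.exp x / Real.exp (V x)) =
        ((1 - η) * (Real.exp (u x) ^ 2 + δ * Real.exp x)) *
          (Real.exp x / (Real.exp (V x) ^ 2 * Real.exp (u x))) := by
        field_simp
        ring
      have e' : Real.exp x / Real.exp (u x) = Real.exp (V x) ^ 2 *
          (Real.exp x / (Real.exp (V x) ^ 2 * Real.exp (u x))) := by
        field_simp
      rw [e, e']
      exact mul_le_mul_of_nonneg_right h6 (by positivity)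
    simp only [zero_mul, add_zero]
    nlinarith
  · have h1 := abs_le.1 (hK₁ x hx)
    have h2 := abs_le.1 (hK₂ x hx)
    have h3 : 0 ≤ defect α 0 V Z x := by
      rw [defect_zero]
      linarith [hV.deriv_le_exp_sub hα x]
    have := mul_nonneg hη h3
    linarith

theorem exists_eq_mul_one_add {p P q Q g ρ : ℝ} (hp : 0 ≤ p) (hpq : p ≤ q) (hgq : g ≤ q)
    (hρ : 0 ≤ ρ) (hρ1 : ρ ≤ 1 / 5) (hPp : P ≤ p) (hpP : (1 - 5 * ρ) * p ≤ P)
    (hQ : 0 ≤ Q - q + (P - p)) (hQg : Q - q + (P - p) ≤ 4 * ρ * g) :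
    ∃ ε, |ε| ≤ 9 * ρ ∧ P * Q = p * q * (1 + ε) := by
  have hP : 0 ≤ P := le_trans (mul_nonneg (by linarith) hp) hpP
  rcases hp.eq_or_lt with rfl | hp0
  · exact ⟨0, by simpa using hρ, by rw [le_antisymm hPp hP]; simp⟩
  have hq0 : 0 < q := hp0.trans_le hpq
  refine ⟨P * Q / (p * q) - 1, ?_, by field_simp; ring⟩
  have e : P * Q / (p * q) - 1 = (P * (Q - q) + (P - p) * q) / (p * q) := by field_simp; ring
  have h1 : 0 ≤ Q - q := by linarith
  have h2 : Q - q ≤ 9 * ρ * q := by nlinarith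
  have h3 : P * (Q - q) ≤ p * (9 * ρ * q) := mul_le_mul hPp h2 h1 hp
  have h4 := mul_nonneg hP h1
  have h5 : (1 - 5 * ρ) * p * q ≤ P * q := by gcongr
  have h6 : P * q ≤ p * q := by gcongr
  have h7 : 0 ≤ ρ * (p * q) := by positivity
  rw [e, abs_le, le_div_iff₀ (by positivity), div_le_iff₀ (by positivity)]
  constructor <;> linarith

end defect

section error

variable {α d m : ℝ} {V Z u z : ℝ → ℝ} {n : ℕ}

/-- Constant governing the relative error in the comparison of finite `n` with its limit. -/
noncomputable def errConst (α d : ℝ) : ℝ :=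
  ((1 + α + 1 / (2 * α)) * (1 + 2 * d) / α + 1) * (max α 1 + (2 * d) ^ ((1 : ℝ) / 3))

theorem errConst_pos (hα : 0 < α) (hd : 0 < d) : 0 < errConst α d := by
  unfold errConst
  have : 0 < max α 1 := lt_max_of_lt_left hα
  positivity

theorem IsSol.error_bounds (hV : IsSol α 1 0 V Z) (hα : 0 < α) (hd : 0 < d) (hm : 1 ≤ m)
    (hmn : m ^ 3 = n) {τ : ℝ} (hτ : Real.exp τ ≤ 2 * n * d) :
    barrier α n τ * (Real.exp (V τ) / α) ≤ errConst α d / m ∧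
      1 / (2 * n) * Real.exp τ ≤ errConst α d / m * Real.exp (V τ) ^ 2 := by
  have hm0 : 0 < m := by linarith
  have hn0 : (0 : ℝ) < n := by rw [← hmn]; positivity
  have hx := hV.exp_le_add hα (le_max_left α 1) (le_max_right α 1) τ
  have hs := hV.exp_le_cube hα le_rfl le_rfl τ
  have hx0 := Real.exp_pos (V τ)
  rw [errConst]
  set c := (2 * d) ^ ((1 : ℝ) / 3) with hc
  set M := max α 1
  set K := 1 + α + 1 / (2 * α) with hK
  have hK0 : 0 < K := by positivity
  have hM : 1 ≤ M := le_max_right _ _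
  have hc0 : 0 < c := by positivity
  have hc3 : c ^ 3 = 2 * d := by
    rw [hc, ← Real.rpow_natCast, ← Real.rpow_mul (by positivity)]; norm_num
  have hy : Real.exp (τ / 3) ≤ c * m := by
    refine le_of_pow_le_pow_left₀ three_ne_zero (by positivity) ?_
    rw [← Real.exp_nat_mul, mul_pow, hc3, hmn]
    refine le_trans (le_of_eq ?_) (hτ.trans (le_of_eq (by ring)))
    congr 1; push_cast; ring
  have hx1 : Real.exp (V τ) ≤ (M + c) * m := by nlinarith
  have hxn : Real.exp (V τ) / n ≤ (M + c) / m := by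
    rw [div_le_div_iff₀ hn0 hm0, ← hmn]
    calc Real.exp (V τ) * m ≤ (M + c) * m * m := by gcongr
      _ = (M + c) * m ^ 2 := by ring
      _ ≤ (M + c) * m ^ 3 := by gcongr; norm_num
  constructor
  · have h1 : barrier α n τ ≤ K * (1 + 2 * d) / n := by
      rw [barrier, ← hK, div_le_div_iff₀ (by positivity) hn0]
      calc K * (n + Real.exp τ) * n ≤ K * (n + 2 * n * d) * n := by gcongr
        _ = _ := by ring
    calc barrier α n τ * (Real.exp (V τ) / α) ≤ K * (1 + 2 * d) / n * (Real.exp (V τ) / α) := by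
          gcongr
      _ = K * (1 + 2 * d) / α * (Real.exp (V τ) / n) := by field_simp
      _ ≤ K * (1 + 2 * d) / α * ((M + c) / m) := by gcongr
      _ ≤ (K * (1 + 2 * d) / α + 1) * ((M + c) / m) := by gcongr; linarith
      _ = _ := by ring
  · have h0 : 0 ≤ K * (1 + 2 * d) / α := by positivity
    calc 1 / (2 * n) * Real.exp τ ≤ 1 / (2 * n) * Real.exp (V τ) ^ 3 := by gcongr
      _ = 1 / 2 * (Real.exp (V τ) / n) * Real.exp (V τ) ^ 2 := by field_simp
      _ ≤ (K * (1 + 2 * d) / α + 1) * ((M + c) / m) * Real.exp (V τ) ^ 2 := by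
        gcongr
        linarith
      _ = _ := by ring

theorem IsSol.exp_bounds (hV : IsSol α 1 0 V Z) (hu : IsSol α (kap α n) (eps n) u z) (hα : 0 < α)
    (hd : 0 < d) (hm : 1 ≤ m) (hmn : m ^ 3 = n) (hρ : errConst α d / m ≤ 1 / 10)
    (hn : 4 * max α 1 ^ 2 / α + 64 / α ^ 3 ≤ n) {τ : ℝ} (hτ : Real.exp τ ≤ 2 * n * d) :
    Real.exp (u τ) - Real.exp (V τ) ≤ 2 * (errConst α d / m) * (Real.exp (V τ) - α) ∧
      (1 - 5 * (errConst α d / m)) * (Real.exp (u τ) ^ 2 + 1 / (2 * n) * Real.exp τ) ≤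
        Real.exp (V τ) ^ 2 := by
  have hn1 : 1 ≤ n := by
    have : (1 : ℝ) ≤ n := by rw [← hmn]; exact one_le_pow₀ hm
    exact_mod_cast this
  have hρ0 : 0 < errConst α d / m := div_pos (errConst_pos hα hd) (by linarith)
  obtain ⟨h1, h2⟩ := hV.error_bounds hα hd hm hmn hτ
  have h3 := hV.le_barrier hu hα hn1 hn τ
  have h4 := exp_sub_exp_le (u τ) (V τ)
  have h5 := Real.add_one_le_exp (V τ - Real.log α)
  rw [Real.exp_sub, Real.exp_log hα] at h5
  have hαx := hV.le_exp hα τ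
  have hb : 0 ≤ barrier α n τ := by unfold barrier; positivity
  set ρ := errConst α d / m
  set x := Real.exp (V τ) with hx
  set X := Real.exp (u τ) with hX
  have hx0 : 0 < x := Real.exp_pos _
  have hX0 : 0 < X := Real.exp_pos _
  have h6 : u τ - V τ ≤ barrier α n τ * ((x - α) / α) := by
    have : V τ - Real.log α ≤ (x - α) / α := by rw [sub_div, div_self hα.ne']; linarith
    nlinarith
  have h7 : u τ - V τ ≤ ρ := by
    refine h6.trans (le_trans ?_ h1)
    gcongr
    linarith
  have h8 : X * (1 - ρ) ≤ x := by nlinarith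
  have h9 : X ≤ (1 + 10 / 9 * ρ) * x := by
    nlinarith [mul_le_mul_of_nonneg_left h8 (show 0 ≤ 1 + 10 / 9 * ρ by linarith),
      mul_nonneg (mul_nonneg hX0.le hρ0.le) (sub_nonneg.2 hρ)]
  constructor
  · calc X - x ≤ X * (barrier α n τ * ((x - α) / α)) := h4.trans (by gcongr)
      _ ≤ (2 * x) * (barrier α n τ * ((x - α) / α)) := by
        have : 0 ≤ (x - α) / α := div_nonneg (by linarith) hα.le
        gcongr
        nlinarith
      _ = 2 * (barrier α n τ * (x / α)) * (x - α) := by field_simp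
      _ ≤ 2 * ρ * (x - α) := by
        have : 0 ≤ x - α := by linarith
        gcongr
  · have h10 : X ^ 2 ≤ (1 + 3 * ρ) * x ^ 2 := by
      calc X ^ 2 ≤ ((1 + 10 / 9 * ρ) * x) ^ 2 := by gcongr
        _ = (1 + 10 / 9 * ρ) ^ 2 * x ^ 2 := by ring
        _ ≤ _ := by gcongr; nlinarith
    have h11 : (1 - 5 * ρ) * (X ^ 2 + 1 / (2 * n) * Real.exp τ) ≤
        (1 - 5 * ρ) * ((1 + 3 * ρ) * x ^ 2 + ρ * x ^ 2) := by
      have : 0 ≤ 1 - 5 * ρ := by linarith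
      gcongr
    nlinarith [sq_nonneg x, mul_nonneg hρ0.le (sq_nonneg x), mul_nonneg (sq_nonneg ρ) (sq_nonneg x)]

theorem IsSol.exists_relative_error (hV : IsSol α 1 0 V Z) (hu : IsSol α (kap α n) (eps n) u z)
    (hα : 0 < α) (hd : 0 < d) (hm : 1 ≤ m) (hmn : m ^ 3 = n) (hρ : errConst α d / m ≤ 1 / 10)
    (hn : 4 * max α 1 ^ 2 / α + 64 / α ^ 3 ≤ n) {t : ℝ} (ht0 : 0 < t) (ht : t ≤ d) :
    ∃ ε, |ε| ≤ 9 * (errConst α d / m) ∧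
      (Real.exp (u (Real.log (2 * n * t))) - α) ^ 2 -
        (z (Real.log (2 * n * t)) + t / Real.exp (u (Real.log (2 * n * t)))) ^ 2 =
      ((Real.exp (V (Real.log (2 * n * t))) - α) ^ 2 - Z (Real.log (2 * n * t)) ^ 2) * (1 + ε) := by
  have hn0 : (0 : ℝ) < n := by rw [← hmn]; positivity
  have hρ0 : 0 < errConst α d / m := div_pos (errConst_pos hα hd) (by linarith)
  set τ := Real.log (2 * n * t) with hτdef
  have hτ : Real.exp τ = 2 * n * t := Real.exp_log (by positivity)
  have hτd : Real.exp τ ≤ 2 * n * d := by rw [hτ]; gcongr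
  have hu' : IsSol α (1 + (1 + α) * (1 / (2 * n))) ((1 / (2 * n)) ^ 2) u z := by
    convert hu using 1
    · rw [kap]; ring
    · rw [eps]; field_simp; norm_num
  have hδ : (0 : ℝ) ≤ 1 / (2 * n) := by positivity
  have hle : V τ ≤ u τ := hu'.mono hV hα zero_le_one le_rfl
    (by linarith [show 0 ≤ (1 + α) * (1 / (2 * n)) by positivity]) (by positivity) τ
  have h1 := hV.defect_le hu' hα hδ τ
  have h2 := hV.le_defect hu' hα hδ (η := 5 * (errConst α d / m)) (T := τ) (by linarith)
    (by linarith) fun y hy => (hV.exp_bounds hu hα hd hm hmn hρ hn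
      (le_trans (Real.exp_le_exp.2 hy) hτd)).2
  have h3 := (hV.exp_bounds hu hα hd hm hmn hρ hn hτd).1
  have h4 := hV.deriv_nonneg hα τ
  have h5 := hV.deriv_le_exp_sub hα τ
  have h6 := Real.exp_le_exp.2 hle
  have ha : 1 / (2 * n) * Real.exp (τ - u τ) = t / Real.exp (u τ) := by
    rw [Real.exp_sub, hτ]; field_simp
  rw [defect_zero] at h1 h2
  rw [defect, ha] at h1 h2
  obtain ⟨ε, hε, h7⟩ := exists_eq_mul_one_add
    (p := Real.exp (V τ) - α - Z τ) (q := Real.exp (V τ) - α + Z τ)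
    (P := Real.exp (u τ) - α - z τ - t / Real.exp (u τ))
    (Q := Real.exp (u τ) - α + z τ + t / Real.exp (u τ)) (g := Real.exp (V τ) - α)
    (by linarith) (by linarith) (by linarith) hρ0.le (by linarith) h1 h2
    (by linarith) (by linarith)
  exact ⟨ε, hε, by linear_combination h7⟩

end error

end PertLaguerre

/-- Fix `α > 0` and `d > 0`. There exist a smooth solution `r` of the
third-order ODE with the prescribed boundary behavior, and constants `C > 0`, `N ∈ ℕ`,
such that for every `n ≥ N` and `t ∈ (0,d]`, writing `s = 2nt`,
`β_n(t) = n² + αn + ((4α² - 1 + 8r(s) - 8s r'(s))/16)(1 + ε_n(t))`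
with `|ε_n(t)| ≤ C n^{-1/3}`. -/
theorem recurrence_beta_asymptotics
    (α d : ℝ) (hα : 0 < α) (hd : 0 < d)
    (P : ℕ → ℝ → ℝ → ℝ) (h : ℕ → ℝ → ℝ) (A B : ℕ → ℝ → ℝ)
    (hmonic : ∀ m : ℕ, ∀ τ > (0:ℝ), ∃ p : Polynomial ℝ,
      p.Monic ∧ p.natDegree = m ∧ ∀ x, P m τ x = p.eval x)
    (horth : ∀ j k : ℕ, ∀ τ > (0:ℝ),
      (∫ x in Ioi (0:ℝ), P j τ x * P k τ x * pertLagWeight α τ x)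
        = if j = k then h j τ else 0)
    (hpos : ∀ j : ℕ, ∀ τ > (0:ℝ), 0 < h j τ)
    (hrec : ∀ m : ℕ, 1 ≤ m → ∀ τ > (0:ℝ), ∀ x : ℝ,
      x * P m τ x = P (m + 1) τ x + A m τ * P m τ x + B m τ * P (m - 1) τ x) :
    ∃ r : ℝ → ℝ,
      (∀ s > (0:ℝ), ContDiffAt ℝ (⊤ : ℕ∞) r s) ∧
      (∀ s > (0:ℝ),
        2 * s ^ 2 * deriv r s * deriv (deriv (deriv r)) s
          - s ^ 2 * (deriv (deriv r) s) ^ 2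
          + 2 * s * deriv r s * deriv (deriv r) s
          - 4 * s * (deriv r s) ^ 3
          + (2 * r s - 1 / 4) * (deriv r s) ^ 2 + 1 = 0) ∧
      Tendsto r (𝓝[>] (0:ℝ)) (𝓝 ((1 - 4 * α ^ 2) / 8)) ∧
      (∃ M > (0:ℝ), ∃ s₁ > (0:ℝ), ∀ s ≥ s₁,
        |r s - ((3 / 2) * s ^ ((2:ℝ) / 3) - α * s ^ ((1:ℝ) / 3))| ≤ M) ∧
      ∃ C > (0:ℝ), ∃ N : ℕ, ∀ n ≥ N, ∀ t ∈ Ioc (0:ℝ) d,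
        ∃ ε : ℝ, |ε| ≤ C * (n : ℝ) ^ (-(1:ℝ) / 3) ∧
          B n t = (n : ℝ) ^ 2 + α * n +
            ((4 * α ^ 2 - 1 + 8 * r (2 * n * t)
              - 8 * (2 * (n : ℝ) * t) * deriv r (2 * n * t)) / 16) * (1 + ε) := by
  obtain ⟨p, hp⟩ := PertLaguerre.exists_isOrtho hmonic horth hpos hrec
  choose! u z hsol hB using fun (n : ℕ) (hn : 1 ≤ n) => PertLaguerre.exists_isSol hα hp n hn
  obtain ⟨V, Z, hV⟩ := PertLaguerre.exists_limit_solution hα hsol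
  refine ⟨PertLaguerre.profile α V Z, fun s hs => hV.contDiffAt_profile hs,
    fun s hs => hV.profile_ode hs, hV.tendsto_profile hα,
    ⟨2 * max α 1 ^ 2 + α * max α 1 + 1, by positivity, 1, one_pos, fun s hs =>
      hV.abs_profile_sub_le hα (by linarith)⟩, ?_⟩
  have hC := PertLaguerre.errConst_pos hα hd
  obtain ⟨N, hN⟩ := exists_nat_ge (max (4 * max α 1 ^ 2 / α + 64 / α ^ 3)
    (max 1 ((10 * PertLaguerre.errConst α d) ^ 3)))
  refine ⟨9 * PertLaguerre.errConst α d, by positivity, N, fun n hn t ht => ?_⟩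
  have hNn := hN.trans (Nat.cast_le.2 hn)
  simp only [max_le_iff] at hNn
  obtain ⟨hn1, hn2, hn3⟩ := hNn
  have hn0 : (0 : ℝ) < n := by linarith
  set m : ℝ := (n : ℝ) ^ ((1 : ℝ) / 3) with hm
  have hm0 : 0 < m := by positivity
  have hmn : m ^ 3 = n := by
    rw [hm, ← Real.rpow_natCast, ← Real.rpow_mul hn0.le]; norm_num
  have hminv : (n : ℝ) ^ (-(1 : ℝ) / 3) = 1 / m := by
    rw [neg_div, Real.rpow_neg hn0.le, one_div m]
  have hρ : PertLaguerre.errConst α d / m ≤ 1 / 10 := by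
    rw [div_le_iff₀ hm0]
    have := le_of_pow_le_pow_left₀ three_ne_zero hm0.le (hn3.trans hmn.ge)
    linarith
  have hn1' : 1 ≤ n := by exact_mod_cast hn2
  have hs : 0 < 2 * (n : ℝ) * t := mul_pos (by linarith) ht.1
  obtain ⟨ε, hε, h1⟩ := hV.exists_relative_error (hsol n hn1') hα hd
    (Real.one_le_rpow hn2 (by norm_num)) hmn hρ hn1 ht.1 ht.2
  refine ⟨ε, hε.trans_eq (by rw [hminv]; ring), ?_⟩
  rw [hB n hn1' t ht.1, h1, hV.deriv_profile hs, PertLaguerre.profile, Real.exp_neg]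
  field_simp
  ring
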